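/- arXiv:1802.06281 — 11 statements merged into one kernel-verified Lean document; each statement's English description precedes it below -/
import Mathlib

section
/- Let S be a semigroup with zero which is 0-left cancellative and right reductive. If an element s of S satisfies sS = S, then S has a two-sided identity element and s is invertible in S. -/
/-- A semigroup with zero is `0`-left cancellative if `s*t = s*r ≠ 0` implies `t = r`. -/
def ZeroLeftCancellative (S : Type*) [SemigroupWithZero S] : Prop :=
  ∀ s t r : S, s * t = s * r → s * t ≠ 0 → t = r

/-- A semigroup is right reductive if it acts faithfully on the left of itself. -/
def RightReductive (S : Type*) [Mul S] : Prop :=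
  ∀ s t : S, (∀ x, s * x = t * x) → s = t

/-- If `S` is a `0`-left cancellative, right reductive semigroup with zero and `sS = S`,
then `S` has a two-sided identity and `s` is invertible. -/
theorem inverseHull.sS_eq_S_implies_invertible {S : Type*} [SemigroupWithZero S]
    (hlc : ZeroLeftCancellative S) (hrr : RightReductive S)
    (s : S) (hs : ∀ y : S, ∃ x : S, s * x = y) :
    ∃ u : S, (∀ t : S, u * t = t ∧ t * u = t) ∧ ∃ v : S, s * v = u ∧ v * s = u := by
  by_cases h0 : s = 0
  · have hz : ∀ t : S, t = 0 := fun t ↦ by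
      obtain ⟨x, hx⟩ := hs t
      rw [← hx, h0, zero_mul]
    exact ⟨0, fun t ↦ ⟨(hz _).trans (hz t).symm, (hz _).trans (hz t).symm⟩, 0, hz _, hz _⟩
  have hss : s * s ≠ 0 := fun h ↦ h0 <| by
    obtain ⟨x, hx⟩ := hs s
    obtain ⟨y, hy⟩ := hs x
    rw [← hx, ← hy, ← mul_assoc, h, zero_mul]
  obtain ⟨e, he⟩ := hs s
  have hes : e * s = s := by
    have h : s * (e * s) = s * s := by rw [← mul_assoc, he]
    exact hlc s _ _ h (h ▸ hss)
  have hl : ∀ t : S, e * t = t := fun t ↦ by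
    obtain ⟨x, rfl⟩ := hs t
    rw [← mul_assoc, hes]
  have hr : ∀ t : S, t * e = t := fun t ↦ hrr _ _ fun x ↦ by rw [mul_assoc, hl]
  obtain ⟨v, hv⟩ := hs e
  have hvs : s * (v * s) = s := by rw [← mul_assoc, hv, hl]
  exact ⟨e, fun t ↦ ⟨hl t, hr t⟩, v, hv,
    hlc s _ _ (hvs.trans he.symm) (by rwa [hvs])⟩
end

section
/- Let S be a semigroup with zero which is 0-left cancellative and right reductive. If e and f are idempotent elements of S with e ≠ f, then ef = 0. -/
/-- In a `0`-left cancellative semigroup, an idempotent fixes every element it does not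
annihilate from the left. -/
theorem ZeroLeftCancellative.idempotent_mul_eq {S : Type*} [SemigroupWithZero S]
    (hlc : ZeroLeftCancellative S) {e x : S} (he : e * e = e) (hx : e * x ≠ 0) :
    e * x = x := by
  have h : e * (e * x) = e * x := by rw [← mul_assoc, he]
  exact hlc e (e * x) x h (h.symm ▸ hx)

/-- If `f` is fixed by left multiplication by `e`, then `e` agrees with the idempotent `f`
on all elements that `f` does not annihilate from the left. -/
theorem ZeroLeftCancellative.mul_eq_mul_of_mul_ne_zero {S : Type*} [SemigroupWithZero S]
    (hlc : ZeroLeftCancellative S) {e f x : S} (hf : f * f = f) (hef : e * f = f)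
    (hx : f * x ≠ 0) : e * x = f * x := by
  calc e * x = e * (f * x) := by rw [hlc.idempotent_mul_eq hf hx]
    _ = f * x := by rw [← mul_assoc, hef]

/-- In a right reductive, `0`-left cancellative semigroup with zero,
two distinct idempotents multiply to `0`. -/
theorem inverseHull.orthogonal_idempotents {S : Type*} [SemigroupWithZero S]
    (hlc : ZeroLeftCancellative S) (hrr : RightReductive S)
    (e f : S) (he : e * e = e) (hf : f * f = f) (hef : e ≠ f) :
    e * f = 0 := by
  by_contra hne
  have hef' : e * f = f := hlc.idempotent_mul_eq he hne
  have hfe : f * e ≠ 0 := by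
    intro h
    have hf0 : f = 0 := by
      calc f = f * (e * f) := by rw [hef', hf]
        _ = 0 := by rw [← mul_assoc, h, zero_mul]
    exact hne (by rw [hf0, mul_zero])
  have hfe' : f * e = e := hlc.idempotent_mul_eq hf hfe
  refine hef (hrr e f fun x => ?_)
  by_cases hfx : f * x = 0
  · by_cases hex : e * x = 0
    · rw [hex, hfx]
    · exact (hlc.mul_eq_mul_of_mul_ne_zero he hfe' hex).symm
  · exact hlc.mul_eq_mul_of_mul_ne_zero hf hef' hfx
end

section
/- Let S be a 0-left cancellative semigroup with zero which is categorical at zero. Then every constructible subset of S' = S \ {0} coincides with R \ {0} for some right ideal R of S (a subset R ⊆ S with Rs ⊆ R for all s in S). -/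
/-- The regular representation: `theta s` is the graph of the partial bijection
`θ_s : F_s → E_s`, `x ↦ s*x`, of `S' = S \ {0}`. -/
def theta {S : Type*} [SemigroupWithZero S] (s : S) : S → S → Prop :=
  fun x y => x ≠ 0 ∧ s * x ≠ 0 ∧ y = s * x

/-- The identity partial bijection on a subset `X`, viewed as a relation. -/
def idOn {α : Type*} (X : Set α) : α → α → Prop := fun x y => x = y ∧ x ∈ X

/-- The inverse subsemigroup of the symmetric inverse semigroup generated by the
partial bijections `π s`, where relations model partial bijections by their graphs:
`Relation.Comp r₁ r₂` applies `r₁` first, and `flip r` is the inverse of `r`. -/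
inductive InHull {S α : Type*} (π : S → α → α → Prop) : (α → α → Prop) → Prop
  | base (s : S) : InHull π (π s)
  | inv {r : α → α → Prop} : InHull π r → InHull π (flip r)
  | comp {r₁ r₂ : α → α → Prop} : InHull π r₁ → InHull π r₂ →
      InHull π (Relation.Comp r₁ r₂)

/-- `X ⊆ S'` is constructible when `id_X` belongs to the idempotent semilattice of the
inverse hull `H(S)` of the regular representation. -/
def Constructible (S : Type*) [SemigroupWithZero S] (X : Set S) : Prop :=
  InHull (theta (S := S)) (idOn X)

/-- Members of the inverse hull only relate nonzero elements, and they are compatible with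
right multiplication as long as one of the two products is nonzero. -/
theorem InHull.ne_zero_and_mul_right {S : Type*} [SemigroupWithZero S]
    (hcat : ∀ r s t : S, r * s ≠ 0 → s * t ≠ 0 → r * (s * t) ≠ 0)
    {r : S → S → Prop} (hr : InHull (theta (S := S)) r) {x y : S} (hxy : r x y) :
    x ≠ 0 ∧ y ≠ 0 ∧ ∀ t, x * t ≠ 0 ∨ y * t ≠ 0 → r (x * t) (y * t) := by
  induction hr generalizing x y with
  | base s =>
    obtain ⟨hx, hsx, rfl⟩ := hxy
    refine ⟨hx, hsx, fun t ht => ?_⟩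
    have hxt : x * t ≠ 0 := by
      rcases ht with h | h
      · exact h
      · intro h0
        exact h (by rw [mul_assoc, h0, mul_zero])
    exact ⟨hxt, hcat s x t hsx hxt, mul_assoc s x t⟩
  | inv _ ih =>
    obtain ⟨hy, hx, h⟩ := ih hxy
    exact ⟨hx, hy, fun t ht => h t ht.symm⟩
  | comp _ _ ih₁ ih₂ =>
    obtain ⟨z, hxz, hzy⟩ := hxy
    obtain ⟨hx, -, h₁⟩ := ih₁ hxz
    obtain ⟨-, hy, h₂⟩ := ih₂ hzy
    refine ⟨hx, hy, fun t ht => ?_⟩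
    rcases ht with ht | ht
    · have h := h₁ t (Or.inl ht)
      exact ⟨z * t, h, h₂ t (Or.inl (ih₁ h).2.1)⟩
    · have h := h₂ t (Or.inr ht)
      exact ⟨z * t, h₁ t (Or.inr (ih₂ h).1), h⟩

/-- If a `0`-left cancellative semigroup with zero is categorical at zero, then every
constructible subset of `S' = S \ {0}` is the set of nonzero elements of a right ideal. -/
theorem inverseHull.constructible_isRightIdeal {S : Type*} [SemigroupWithZero S]
    (hlc : ZeroLeftCancellative S)
    (hcat : ∀ r s t : S, r * s ≠ 0 → s * t ≠ 0 → r * (s * t) ≠ 0)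
    (X : Set S) (hX0 : (0 : S) ∉ X) (hX : Constructible S X) :
    ∃ R : Set S, (∀ r ∈ R, ∀ s : S, r * s ∈ R) ∧ X = R \ {0} := by
  refine ⟨insert 0 X, fun r hr s => ?_, (Set.insert_sdiff_self_of_notMem hX0).symm⟩
  rcases hr with rfl | hr
  · exact Or.inl (zero_mul s)
  · by_cases h : r * s = 0
    · exact Or.inl h
    · have hmul := (hX.ne_zero_and_mul_right hcat ⟨rfl, hr⟩).2.2 s (Or.inl h)
      exact Or.inr hmul.2
end

section
/- Let S be a 0-left cancellative semigroup with zero admitting least common multiples, and let π be a representation of S on a set Ω that respects least common multiples. Then the inverse semigroup I(Ω,π) equals the set of all maps π_u ∘ f^π_Λ ∘ π_v^{-1}, where Λ ranges over the finite subsets of ~S with Λ ∩ S ≠ ∅ and u, v ∈ Λ. -/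
/-- `s` divides `t` when `t ∈ {s} ∪ sS`. -/
def Divides {S : Type*} [Mul S] (s t : S) : Prop := t = s ∨ ∃ u, s * u = t

/-- `r` is a least common multiple of `s` and `t` when `sS ∩ tS = rS` and both `s` and `t`
divide `r`. -/
def IsLCM {S : Type*} [Mul S] (s t r : S) : Prop :=
  ({x | ∃ u, x = s * u} ∩ {x | ∃ u, x = t * u} = {x | ∃ u, x = r * u}) ∧
    Divides s r ∧ Divides t r

/-- The extension of a representation `π` of `S` on `Ω` to `~S = S ∪ {1}`
(modelled as `Option S`, with `none` playing the role of the adjoined unit `1`,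
represented by the identity map of `Ω`). -/
def erep {S Ω : Type*} (π : S → Ω → Ω → Prop) : Option S → Ω → Ω → Prop
  | none => Eq
  | some s => π s

namespace inverseHull

/-- Multiplication on `~S`, the semigroup `S` with an external identity adjoined. -/
def emul {S : Type*} [Mul S] : Option S → Option S → Option S
  | none, b => b
  | some a, none => some a
  | some a, some b => some (a * b)

section erep

variable {S Ω : Type*} {π : S → Ω → Ω → Prop}

theorem erep_functional (hfun : ∀ (s : S) (x y y' : Ω), π s x y → π s x y' → y = y')
    {w : Option S} {x y y' : Ω} (h : erep π w x y) (h' : erep π w x y') : y = y' := by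
  cases w with
  | none => exact h.symm.trans h'
  | some s => exact hfun s x y y' h h'

theorem erep_injective (hinj : ∀ (s : S) (x x' y : Ω), π s x y → π s x' y → x = x')
    {w : Option S} {x x' y : Ω} (h : erep π w x y) (h' : erep π w x' y) : x = x' := by
  cases w with
  | none => exact h.trans h'.symm
  | some s => exact hinj s x x' y h h'

theorem erep_emul [Mul S] (hmul : ∀ s t : S, π (s * t) = Relation.Comp (π t) (π s))
    (a b : Option S) (x y : Ω) :
    erep π (emul a b) x y ↔ ∃ m, erep π b x m ∧ erep π a m y := by
  cases a <;> cases b <;> simp [emul, erep, hmul, Relation.Comp]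

theorem exists_emul_eq_of_divides [Mul S] {s r : S} (h : Divides s r) :
    ∃ p : Option S, emul (some s) p = some r := by
  rcases h with rfl | ⟨p, rfl⟩
  · exact ⟨none, rfl⟩
  · exact ⟨some p, rfl⟩

/-- Any two elements of `~S` have a common multiple whose range contains the intersection
of their ranges. -/
theorem exists_emul_eq_emul [Mul S] (hlcm : ∀ s t : S, ∃ r : S, IsLCM s t r)
    (hresp : ∀ s t r : S, IsLCM s t r →
        {y : Ω | ∃ x, π r x y} = {y : Ω | ∃ x, π s x y} ∩ {y : Ω | ∃ x, π t x y})
    (v s : Option S) :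
    ∃ p q : Option S, emul v p = emul s q ∧
      ∀ m x y, erep π v m y → erep π s x y → ∃ k, erep π (emul v p) k y := by
  cases v with
  | none => exact ⟨s, none, by cases s <;> rfl, fun m x y _ h => ⟨x, h⟩⟩
  | some v =>
    cases s with
    | none => exact ⟨none, some v, rfl, fun m x y h _ => ⟨m, h⟩⟩
    | some s =>
      obtain ⟨r, hr⟩ := hlcm v s
      obtain ⟨p, hp⟩ := exists_emul_eq_of_divides hr.2.1
      obtain ⟨q, hq⟩ := exists_emul_eq_of_divides hr.2.2
      refine ⟨p, q, hp.trans hq.symm, fun m x y hm hx => ?_⟩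
      rw [hp]
      exact (hresp v s r hr).ge ⟨⟨m, hm⟩, ⟨x, hx⟩⟩

theorem inHull_comp_erep {g : Ω → Ω → Prop} (hg : InHull π g) (u : Option S) :
    InHull π (Relation.Comp g (erep π u)) := by
  cases u with
  | none => simpa only [erep, Relation.comp_eq] using hg
  | some s => exact hg.comp (.base s)

theorem inHull_flip_erep_comp {g : Ω → Ω → Prop} (hg : InHull π g) (v : Option S) :
    InHull π (Relation.Comp (flip (erep π v)) g) := by
  have h := (inHull_comp_erep hg.inv v).inv
  rwa [Relation.flip_comp] at h

theorem inHull_restrict (hinj : ∀ (s : S) (x x' y : Ω), π s x y → π s x' y → x = x')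
    {g : Ω → Ω → Prop} (hg : InHull π g) (Λ : Finset (Option S)) :
    InHull π (fun x z => (∀ w ∈ Λ, ∃ y, erep π w x y) ∧ g x z) := by
  classical
  induction Λ using Finset.induction_on with
  | empty => simpa using hg
  | insert w Λ _ ih =>
    cases w with
    | none => simpa [erep] using ih
    | some s =>
      convert ((InHull.base s).comp (InHull.base s).inv).comp ih using 1
      funext x z
      simp only [Finset.forall_mem_insert, eq_iff_iff]
      constructor
      · rintro ⟨⟨⟨y, hy⟩, h⟩, hxz⟩
        exact ⟨x, ⟨y, hy, hy⟩, h, hxz⟩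
      · rintro ⟨x', ⟨y, hy, hy'⟩, h, hxz⟩
        obtain rfl := hinj s x x' y hy hy'
        exact ⟨⟨⟨y, hy⟩, h⟩, hxz⟩

end erep

end inverseHull

/-- Normal form for the inverse semigroup `I(Ω,π)` generated by a representation `π`
of a `0`-left cancellative semigroup admitting least common multiples, provided `π`
respects least common multiples:  `I(Ω,π)` consists exactly of the maps
`π_u ∘ f^π_Λ ∘ π_v⁻¹` for `Λ ⊆ ~S` finite with `Λ ∩ S ≠ ∅` and `u, v ∈ Λ`. -/
theorem inverseHull.genFormHull {S Ω : Type*} [SemigroupWithZero S]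
    (hlc : ZeroLeftCancellative S)
    (hlcm : ∀ s t : S, ∃ r : S, IsLCM s t r)
    (π : S → Ω → Ω → Prop)
    (hfun : ∀ (s : S) (x y y' : Ω), π s x y → π s x y' → y = y')
    (hinj : ∀ (s : S) (x x' y : Ω), π s x y → π s x' y → x = x')
    (hzero : ∀ x y : Ω, ¬ π 0 x y)
    (hmul : ∀ s t : S, π (s * t) = Relation.Comp (π t) (π s))
    (hresp : ∀ s t r : S, IsLCM s t r →
        {y : Ω | ∃ x, π r x y} = {y : Ω | ∃ x, π s x y} ∩ {y : Ω | ∃ x, π t x y}) :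
    ∀ g : Ω → Ω → Prop,
      InHull π g ↔
        ∃ (Λ : Finset (Option S)) (u v : Option S),
          (∃ s : S, some s ∈ Λ) ∧ u ∈ Λ ∧ v ∈ Λ ∧
          g = fun x z => ∃ m : Ω,
            erep π v m x ∧ (∀ w ∈ Λ, ∃ y, erep π w m y) ∧ erep π u m z := by
  classical
  intro g
  constructor
  · intro hg
    induction hg with
    | base s =>
      refine ⟨{some s, none}, some s, none, ⟨s, by simp⟩, by simp, by simp, ?_⟩
      funext x z
      simp only [Finset.forall_mem_insert, Finset.mem_singleton, forall_eq, eq_iff_iff]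
      constructor
      · exact fun h => ⟨x, rfl, ⟨⟨z, h⟩, x, rfl⟩, h⟩
      · rintro ⟨m, rfl, _, h⟩
        exact h
    | inv _ ih =>
      obtain ⟨Λ, u, v, hΛ, hu, hv, rfl⟩ := ih
      refine ⟨Λ, v, u, hΛ, hv, hu, ?_⟩
      funext x z
      exact propext ⟨fun ⟨m, h₁, h₂, h₃⟩ => ⟨m, h₃, h₂, h₁⟩,
        fun ⟨m, h₁, h₂, h₃⟩ => ⟨m, h₃, h₂, h₁⟩⟩
    | comp _ _ ih₁ ih₂ =>
      obtain ⟨Λ₁, u₁, v₁, ⟨s, hs⟩, hu₁, hv₁, rfl⟩ := ih₁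
      obtain ⟨Λ₂, u₂, v₂, -, hu₂, hv₂, rfl⟩ := ih₂
      obtain ⟨p, q, hpq, hk⟩ := exists_emul_eq_emul hlcm hresp v₂ u₁
      refine ⟨Λ₁.image (emul · q) ∪ Λ₂.image (emul · p), emul u₂ p, emul v₁ q, ?_,
        Finset.mem_union_right _ (Finset.mem_image_of_mem _ hu₂),
        Finset.mem_union_left _ (Finset.mem_image_of_mem _ hv₁), ?_⟩
      · have hmem := Finset.mem_union_left (Λ₂.image (emul · p))
          (Finset.mem_image_of_mem (emul · q) hs)
        cases q with
        | none => exact ⟨s, hmem⟩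
        | some q => exact ⟨s * q, hmem⟩
      · funext x z
        simp only [Finset.forall_mem_union, Finset.forall_mem_image, erep_emul hmul, eq_iff_iff]
        constructor
        · rintro ⟨y, ⟨m₁, hx, hΛ₁, hy₁⟩, m₂, hy₂, hΛ₂, hz⟩
          obtain ⟨k, hky⟩ := hk m₂ m₁ y hy₂ hy₁
          obtain ⟨m₂', hp, hy₂'⟩ := (erep_emul hmul v₂ p k y).1 hky
          obtain ⟨m₁', hq, hy₁'⟩ := (erep_emul hmul u₁ q k y).1 (hpq ▸ hky)
          obtain rfl := erep_injective hinj hy₂ hy₂'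
          obtain rfl := erep_injective hinj hy₁ hy₁'
          exact ⟨k, ⟨m₁, hq, hx⟩,
            ⟨fun w hw => (hΛ₁ w hw).imp fun _ h => ⟨m₁, hq, h⟩,
              fun w hw => (hΛ₂ w hw).imp fun _ h => ⟨m₂, hp, h⟩⟩, m₂, hp, hz⟩
        · rintro ⟨k, ⟨m₁, hq, hx⟩, ⟨hΛ₁, hΛ₂⟩, m₂, hp, hz⟩
          have h₁ : ∀ w ∈ Λ₁, ∃ y, erep π w m₁ y := fun w hw => by
            obtain ⟨y, m, hm, hy⟩ := hΛ₁ hw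
            exact ⟨y, erep_functional hfun hm hq ▸ hy⟩
          have h₂ : ∀ w ∈ Λ₂, ∃ y, erep π w m₂ y := fun w hw => by
            obtain ⟨y, m, hm, hy⟩ := hΛ₂ hw
            exact ⟨y, erep_functional hfun hm hp ▸ hy⟩
          obtain ⟨y, hy⟩ := h₂ v₂ hv₂
          obtain ⟨m, hm, hy'⟩ := (erep_emul hmul u₁ q k y).1
            (hpq ▸ (erep_emul hmul v₂ p k y).2 ⟨m₂, hp, hy⟩)
          obtain rfl := erep_functional hfun hm hq
          exact ⟨y, ⟨m, hx, h₁, hy'⟩, m₂, hy, h₂, hz⟩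
  · rintro ⟨Λ, u, v, ⟨s, hs⟩, -, -, rfl⟩
    convert inHull_flip_erep_comp (inHull_comp_erep (inHull_restrict hinj
      ((InHull.base s).comp (InHull.base s).inv) Λ) u) v using 1
    funext x z
    rw [eq_iff_iff]
    constructor
    · rintro ⟨m, hx, hΛ, hz⟩
      obtain ⟨y, hy⟩ := hΛ _ hs
      exact ⟨m, hx, m, ⟨hΛ, y, hy, hy⟩, hz⟩
    · rintro ⟨m, hx, m', ⟨hΛ, y, hy, hy'⟩, hz⟩
      obtain rfl := hinj s m m' y hy hy'
      exact ⟨m, hx, hΛ, hz⟩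
end

section
/- Let S be a 0-left cancellative semigroup with zero admitting least common multiples and having right local units, and let π be a representation of S on a set Ω that respects least common multiples. Then every nonzero element of I(Ω,π) may be written as π_s ∘ f^π_Λ ∘ π_t^{-1} where Λ is a nonempty finite subset of S and s, t ∈ Λ. If moreover S is right reductive, one may also arrange that s⁺ = t⁺ and Λ ⊆ Ss⁺. -/
/-- The partial bijection `π_s ∘ f_Λ ∘ π_t⁻¹`, as a relation. -/
def hullForm {S Ω : Type*} (π : S → Ω → Ω → Prop) (Λ : Finset S) (s t : S) : Ω → Ω → Prop :=
  fun x z => ∃ m : Ω, π t m x ∧ (∀ w ∈ Λ, ∃ y, π w m y) ∧ π s m z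

theorem hullForm_flip {S Ω : Type*} (π : S → Ω → Ω → Prop) (Λ : Finset S) (s t : S) :
    flip (hullForm π Λ s t) = hullForm π Λ t s := by
  funext x z
  exact propext ⟨fun ⟨m, h₁, h₂, h₃⟩ => ⟨m, h₃, h₂, h₁⟩, fun ⟨m, h₁, h₂, h₃⟩ => ⟨m, h₃, h₂, h₁⟩⟩

/-- If `e` is a right local unit of `s`, then `π_s = π_s ∘ f_{s,e} ∘ π_e⁻¹`. -/
theorem eq_hullForm_of_mul_eq {S Ω : Type*} [Mul S] [DecidableEq S] {π : S → Ω → Ω → Prop}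
    (hfun : ∀ (s : S) (x y y' : Ω), π s x y → π s x y' → y = y')
    (hinj : ∀ (s : S) (x x' y : Ω), π s x y → π s x' y → x = x')
    (hmul : ∀ s t : S, π (s * t) = Relation.Comp (π t) (π s))
    {s e : S} (he : e * e = e) (hse : s * e = s) :
    π s = hullForm π {s, e} s e := by
  have fixed {x y : Ω} (h : π e x y) : x = y := by
    have h' := h
    rw [← he, hmul] at h'
    obtain ⟨a, h₁, h₂⟩ := h'
    exact (hinj e _ _ _ h₂ (hfun e _ _ _ h₁ h ▸ h₁)).symm.trans (hfun e _ _ _ h₁ h)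
  funext x z
  refine propext ⟨fun h => ?_, ?_⟩
  · have h' := h
    rw [← hse, hmul] at h'
    obtain ⟨a, h₁, -⟩ := h'
    obtain rfl := fixed h₁
    refine ⟨x, h₁, ?_, h⟩
    simp only [Finset.mem_insert, Finset.mem_singleton]
    rintro w (rfl | rfl)
    exacts [⟨z, h⟩, ⟨x, h₁⟩]
  · rintro ⟨m, h₁, -, h₂⟩
    obtain rfl := fixed h₁
    exact h₂

/-- Composition of forms along a common multiple `v * p = s * q` whose range is the intersection
of the ranges of `π_v` and `π_s`. -/
theorem comp_hullForm {S Ω : Type*} [Mul S] [DecidableEq S] {π : S → Ω → Ω → Prop}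
    (hfun : ∀ (s : S) (x y y' : Ω), π s x y → π s x y' → y = y')
    (hinj : ∀ (s : S) (x x' y : Ω), π s x y → π s x' y → x = x')
    (hmul : ∀ s t : S, π (s * t) = Relation.Comp (π t) (π s))
    {s t u v p q : S} {Λ Γ : Finset S} (hv : v ∈ Γ) (hpq : v * p = s * q)
    (hrange : ∀ y, (∃ m, π v m y) → (∃ m, π s m y) → ∃ n, π (v * p) n y) :
    Relation.Comp (hullForm π Λ s t) (hullForm π Γ u v) =
      hullForm π (Γ.image (· * p) ∪ Λ.image (· * q)) (u * p) (t * q) := by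
  funext x z
  refine propext ⟨?_, ?_⟩
  · rintro ⟨y, ⟨m, htm, hΛ, hsm⟩, m', hvm, hΓ, hum⟩
    obtain ⟨n, hn⟩ := hrange y ⟨m', hvm⟩ ⟨m, hsm⟩
    have hn' := hn
    rw [hpq, hmul] at hn'
    rw [hmul] at hn
    obtain ⟨a, hpa, hva⟩ := hn
    obtain ⟨b, hqb, hsb⟩ := hn'
    obtain rfl := hinj _ _ _ _ hva hvm
    obtain rfl := hinj _ _ _ _ hsb hsm
    refine ⟨n, ?_, ?_, ?_⟩
    · rw [hmul]
      exact ⟨b, hqb, htm⟩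
    · intro w hw
      rcases Finset.mem_union.mp hw with hw | hw <;> obtain ⟨w', hw', rfl⟩ := Finset.mem_image.mp hw
      · obtain ⟨c, hc⟩ := hΓ w' hw'
        exact ⟨c, by rw [hmul]; exact ⟨a, hpa, hc⟩⟩
      · obtain ⟨c, hc⟩ := hΛ w' hw'
        exact ⟨c, by rw [hmul]; exact ⟨b, hqb, hc⟩⟩
    · rw [hmul]
      exact ⟨a, hpa, hum⟩
  · rintro ⟨n, ht, hall, hu⟩
    rw [hmul] at ht hu
    obtain ⟨m, hqm, htm⟩ := ht
    obtain ⟨m', hpm, hum⟩ := hu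
    have hΓ : ∀ w ∈ Γ, ∃ y, π w m' y := by
      intro w hw
      obtain ⟨c, hc⟩ := hall _ (Finset.mem_union_left _ (Finset.mem_image_of_mem _ hw))
      rw [hmul] at hc
      obtain ⟨a, ha, hac⟩ := hc
      exact ⟨c, hfun _ _ _ _ ha hpm ▸ hac⟩
    have hΛ : ∀ w ∈ Λ, ∃ y, π w m y := by
      intro w hw
      obtain ⟨c, hc⟩ := hall _ (Finset.mem_union_right _ (Finset.mem_image_of_mem _ hw))
      rw [hmul] at hc
      obtain ⟨a, ha, hac⟩ := hc
      exact ⟨c, hfun _ _ _ _ ha hqm ▸ hac⟩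
    obtain ⟨y, hvy⟩ := hΓ v hv
    have hr : π (v * p) n y := by
      rw [hmul]
      exact ⟨m', hpm, hvy⟩
    rw [hpq, hmul] at hr
    obtain ⟨b, hqb, hsb⟩ := hr
    exact ⟨y, ⟨m, htm, hΛ, hfun _ _ _ _ hqb hqm ▸ hsb⟩, m', hvy, hΓ, hum⟩

theorem Divides.exists_mul_eq {S : Type*} [Mul S] {s r e : S} (h : Divides s r) (he : s * e = s) :
    ∃ u, s * u = r := by
  rcases h with rfl | h
  exacts [⟨e, he⟩, h]

theorem InHull.exists_eq_hullForm {S Ω : Type*} [SemigroupWithZero S]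
    (hlc : ZeroLeftCancellative S)
    (hrlu : ∀ s : S, ∃ e : S, e * e = e ∧ s * e = s)
    (hlcm : ∀ s t : S, ∃ r : S, IsLCM s t r)
    {π : S → Ω → Ω → Prop}
    (hfun : ∀ (s : S) (x y y' : Ω), π s x y → π s x y' → y = y')
    (hinj : ∀ (s : S) (x x' y : Ω), π s x y → π s x' y → x = x')
    (hzero : ∀ x y : Ω, ¬ π 0 x y)
    (hmul : ∀ s t : S, π (s * t) = Relation.Comp (π t) (π s))
    (hresp : ∀ s t r : S, IsLCM s t r →
        {y : Ω | ∃ x, π r x y} = {y : Ω | ∃ x, π s x y} ∩ {y : Ω | ∃ x, π t x y})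
    {g : Ω → Ω → Prop} (hg : InHull π g) (hne : ∃ x y : Ω, g x y) :
    ∃ (Λ : Finset S) (s t e : S), s ∈ Λ ∧ t ∈ Λ ∧
      e * e = e ∧ s * e = s ∧ t * e = t ∧ (∀ w ∈ Λ, ∃ a : S, w = a * e) ∧
      g = hullForm π Λ s t := by
  classical
  induction hg with
  | base s =>
    obtain ⟨e, he, hse⟩ := hrlu s
    refine ⟨{s, e}, s, e, e, by simp, by simp, he, hse, he, ?_,
      eq_hullForm_of_mul_eq hfun hinj hmul he hse⟩
    simp only [Finset.mem_insert, Finset.mem_singleton]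
    rintro w (rfl | rfl)
    exacts [⟨w, hse.symm⟩, ⟨w, he.symm⟩]
  | inv _ ih =>
    obtain ⟨x, y, h⟩ := hne
    obtain ⟨Λ, s, t, e, hs, ht, he, hse, hte, hΛ, rfl⟩ := ih ⟨y, x, h⟩
    exact ⟨Λ, t, s, e, ht, hs, he, hte, hse, hΛ, hullForm_flip π Λ s t⟩
  | comp _ _ ih₁ ih₂ =>
    obtain ⟨x, z, y, h₁, h₂⟩ := hne
    obtain ⟨Λ, s, t, e, hs, ht, he, hse, hte, hΛ, rfl⟩ := ih₁ ⟨x, y, h₁⟩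
    obtain ⟨Γ, u, v, f, hu, hv, hf, huf, hvf, hΓ, rfl⟩ := ih₂ ⟨y, z, h₂⟩
    obtain ⟨r, hr⟩ := hlcm v s
    have hE := hresp v s r hr
    obtain ⟨p, rfl⟩ := hr.2.1.exists_mul_eq hvf
    obtain ⟨q, hq⟩ := hr.2.2.exists_mul_eq hse
    have hrange : ∀ y, (∃ m, π v m y) → (∃ m, π s m y) → ∃ n, π (v * p) n y :=
      fun y hvy hsy => hE.ge ⟨hvy, hsy⟩
    have hne0 : v * p ≠ 0 := by
      intro h0
      obtain ⟨m, -, -, hsm⟩ := h₁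
      obtain ⟨m', hvm, -, -⟩ := h₂
      obtain ⟨n, hn⟩ := hrange y ⟨m', hvm⟩ ⟨m, hsm⟩
      exact hzero n y (h0 ▸ hn)
    obtain ⟨d, hd, hrd⟩ := hrlu (v * p)
    have hp : p * d = p := (hlc v p (p * d) (by rw [← mul_assoc, hrd]) hne0).symm
    have hqd : q * d = q :=
      (hlc s q (q * d) (by rw [← mul_assoc, hq, hrd]) (hq ▸ hne0)).symm
    refine ⟨Γ.image (· * p) ∪ Λ.image (· * q), u * p, t * q, d,
      Finset.mem_union_left _ (Finset.mem_image_of_mem _ hu),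
      Finset.mem_union_right _ (Finset.mem_image_of_mem _ ht), hd, by rw [mul_assoc, hp],
      by rw [mul_assoc, hqd], ?_, comp_hullForm hfun hinj hmul hv hq.symm hrange⟩
    intro w hw
    refine ⟨w, ?_⟩
    rcases Finset.mem_union.mp hw with hw | hw <;> obtain ⟨w, -, rfl⟩ := Finset.mem_image.mp hw
    · simp only [mul_assoc, hp]
    · simp only [mul_assoc, hqd]

/-- Let `S` be a `0`-left cancellative semigroup with zero, admitting least common
multiples and right local units, and let `π` be a representation of `S` on `Ω`
respecting least common multiples.  Then every nonzero element of `I(Ω,π)` can be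
written as `π_s ∘ f^π_Λ ∘ π_t⁻¹` with `Λ ⊆ S` finite nonempty and `s, t ∈ Λ`; and if
moreover `S` is right reductive, one may also arrange `s⁺ = t⁺` and `Λ ⊆ Ss⁺`
(witnessed by a common idempotent `e` with `s*e = s`, `t*e = t` and `Λ ⊆ Se`). -/
theorem inverseHull.locUnitsFormOfHull {S Ω : Type*} [SemigroupWithZero S]
    (hlc : ZeroLeftCancellative S)
    (hrlu : ∀ s : S, ∃ e : S, e * e = e ∧ s * e = s)
    (hlcm : ∀ s t : S, ∃ r : S, IsLCM s t r)
    (π : S → Ω → Ω → Prop)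
    (hfun : ∀ (s : S) (x y y' : Ω), π s x y → π s x y' → y = y')
    (hinj : ∀ (s : S) (x x' y : Ω), π s x y → π s x' y → x = x')
    (hzero : ∀ x y : Ω, ¬ π 0 x y)
    (hmul : ∀ s t : S, π (s * t) = Relation.Comp (π t) (π s))
    (hresp : ∀ s t r : S, IsLCM s t r →
        {y : Ω | ∃ x, π r x y} = {y : Ω | ∃ x, π s x y} ∩ {y : Ω | ∃ x, π t x y}) :
    ∀ g : Ω → Ω → Prop, InHull π g → (∃ x y : Ω, g x y) →
      (∃ (Λ : Finset S) (s t : S), s ∈ Λ ∧ t ∈ Λ ∧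
        g = fun x z => ∃ m : Ω, π t m x ∧ (∀ w ∈ Λ, ∃ y, π w m y) ∧ π s m z) ∧
      (RightReductive S →
        ∃ (Λ : Finset S) (s t e : S), s ∈ Λ ∧ t ∈ Λ ∧
          e * e = e ∧ s * e = s ∧ t * e = t ∧ (∀ w ∈ Λ, ∃ a : S, w = a * e) ∧
          g = fun x z => ∃ m : Ω, π t m x ∧ (∀ w ∈ Λ, ∃ y, π w m y) ∧ π s m z) := by
  intro g hg hne
  obtain ⟨Λ, s, t, e, hs, ht, he, hse, hte, hΛ, hform⟩ :=
    hg.exists_eq_hullForm hlc hrlu hlcm hfun hinj hzero hmul hresp hne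
  exact ⟨⟨Λ, s, t, hs, ht, hform⟩, fun _ => ⟨Λ, s, t, e, hs, ht, he, hse, hte, hΛ, hform⟩⟩
end

section
/- Let S be a semigroup with zero that is categorical at zero, 0-left cancellative, right reductive, has right local units, and admits least common multiples. Then the nonzero elements of the inverse hull H(S) are precisely the maps θ_s θ_t^{-1} with s, t ∈ S \ {0} and s⁺ = t⁺. Moreover, if s_1⁺ = t_1⁺ and s_2⁺ = t_2⁺, then θ_{s_1}θ_{t_1}^{-1} = θ_{s_2}θ_{t_2}^{-1} if and only if there exist x, y ∈ S with xy = s_1⁺, yx = s_2⁺, s_1 x = s_2, t_1 x = t_2, s_2 y = s_1, and t_2 y = t_1. -/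
/-- The element `θ_s ∘ θ_t⁻¹` of the inverse hull, as a relation on `S`. -/
def pairRel {S : Type*} [SemigroupWithZero S] (s t : S) : S → S → Prop :=
  fun x z => ∃ m, theta t m x ∧ theta s m z

theorem pairRel_iff {S : Type*} [SemigroupWithZero S] {s t x z : S} :
    pairRel s t x z ↔ ∃ m, t * m ≠ 0 ∧ s * m ≠ 0 ∧ x = t * m ∧ z = s * m := by
  constructor
  · rintro ⟨m, ⟨-, h1, rfl⟩, -, h2, rfl⟩
    exact ⟨m, h1, h2, rfl, rfl⟩
  · rintro ⟨m, h1, h2, rfl, rfl⟩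
    have hm : m ≠ 0 := right_ne_zero_of_mul h1
    exact ⟨m, ⟨hm, h1, rfl⟩, hm, h2, rfl⟩

theorem flip_pairRel {S : Type*} [SemigroupWithZero S] (s t : S) :
    flip (pairRel s t) = pairRel t s := by
  ext x z
  exact exists_congr fun m => and_comm

theorem InHull.pairRel {S : Type*} [SemigroupWithZero S] (s t : S) :
    InHull (theta (S := S)) (pairRel s t) :=
  .comp (.inv (.base t)) (.base s)

theorem pairRel_self_apply {S : Type*} [SemigroupWithZero S] {s t e : S}
    (hs : s ≠ 0) (ht : t ≠ 0) (hse : s * e = s) (hte : t * e = t) : pairRel s t t s :=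
  pairRel_iff.2 ⟨e, by rwa [hte], by rwa [hse], hte.symm, hse.symm⟩

/-- A right local unit of `s` acts as a left identity on the domain of `θ_s`. -/
theorem ZeroLeftCancellative.unit_mul {S : Type*} [SemigroupWithZero S]
    (hlc : ZeroLeftCancellative S) {s e x : S} (hse : s * e = s) (hx : s * x ≠ 0) :
    e * x = x := by
  have h : s * (e * x) = s * x := by rw [← mul_assoc, hse]
  exact hlc s _ _ h (h ▸ hx)

/-- Elements with a common right local unit have regular representations with equal domains. -/
theorem ZeroLeftCancellative.mul_ne_zero_of_unit {S : Type*} [SemigroupWithZero S]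
    (hcat : ∀ r s t : S, r * s ≠ 0 → s * t ≠ 0 → r * (s * t) ≠ 0)
    (hlc : ZeroLeftCancellative S) {s t e x : S} (hs : s ≠ 0)
    (hse : s * e = s) (hte : t * e = t) (hx : t * x ≠ 0) : s * x ≠ 0 := by
  have hex := hlc.unit_mul hte hx
  have h := hcat s e x (by rwa [hse]) (by rw [hex]; exact right_ne_zero_of_mul hx)
  rwa [hex] at h

theorem theta_eq_pairRel {S : Type*} [SemigroupWithZero S]
    (hlc : ZeroLeftCancellative S) {s e : S} (he : e * e = e) (hse : s * e = s) :
    theta s = pairRel s e := by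
  ext x z
  rw [pairRel_iff]
  constructor
  · rintro ⟨hx, hsx, rfl⟩
    have h := hlc.unit_mul hse hsx
    exact ⟨x, by rwa [h], hsx, h.symm, rfl⟩
  · rintro ⟨m, h1, h2, rfl, rfl⟩
    have h := hlc.unit_mul he h1
    rw [h]
    exact ⟨right_ne_zero_of_mul h1, h2, rfl⟩

theorem IsLCM.exists_mul_eq {S : Type*} [SemigroupWithZero S]
    (hrlu : ∀ s : S, ∃ e : S, e * e = e ∧ s * e = s) {s t r : S} (h : IsLCM s t r) :
    (∃ p, s * p = r) ∧ ∃ q, t * q = r := by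
  have key : ∀ {a : S}, Divides a r → ∃ p, a * p = r := by
    rintro a (rfl | h)
    · exact (hrlu _).imp fun _ h => h.2
    · exact h
  exact ⟨key h.2.1, key h.2.2⟩

/-- The product `(θ_s θ_t⁻¹)(θ_u θ_v⁻¹)` equals `θ_{sp} θ_{vq}⁻¹`, where `t * p = u * q` is a
nonzero least common multiple of `t` and `u`. -/
theorem comp_pairRel {S : Type*} [SemigroupWithZero S]
    (hcat : ∀ r s t : S, r * s ≠ 0 → s * t ≠ 0 → r * (s * t) ≠ 0)
    (hlc : ZeroLeftCancellative S) {s t u v p q r : S} (hr : IsLCM t u r) (hr0 : r ≠ 0)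
    (hp : t * p = r) (hq : u * q = r) :
    Relation.Comp (pairRel u v) (pairRel s t) = pairRel (s * p) (v * q) := by
  ext x z
  simp only [Relation.Comp, pairRel_iff]
  constructor
  · rintro ⟨y, ⟨m, h1, h2, rfl, rfl⟩, n, h3, h4, h5, rfl⟩
    obtain ⟨k, hk⟩ : ∃ k, u * m = r * k := by
      have : u * m ∈ {x | ∃ w, x = t * w} ∩ {x | ∃ w, x = u * w} := ⟨⟨n, h5⟩, m, rfl⟩
      rwa [hr.1] at this
    have hm : m = q * k := hlc u _ _ (by rw [hk, ← hq, mul_assoc]) h2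
    have hn : n = p * k := hlc t _ _ (by rw [← h5, hk, ← hp, mul_assoc]) h3
    subst hm hn
    simp only [mul_assoc]
    exact ⟨k, h1, h4, rfl, rfl⟩
  · rintro ⟨k, h1, h2, rfl, rfl⟩
    simp only [mul_assoc] at h1 h2 ⊢
    refine ⟨u * (q * k), ⟨q * k, h1, ?_, rfl, rfl⟩, p * k, ?_, h2, ?_, rfl⟩
    · exact hcat u q k (hq ▸ hr0) (right_ne_zero_of_mul h1)
    · exact hcat t p k (hp ▸ hr0) (right_ne_zero_of_mul h2)
    · rw [← mul_assoc, ← mul_assoc, hp, hq]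

/-- The composite of two maps `θ_s θ_t⁻¹` vanishes when the inner factors have least common
multiple `0`. -/
theorem not_comp_pairRel_of_isLCM_zero {S : Type*} [SemigroupWithZero S] {s t u v : S}
    (hr : IsLCM t u 0) (x z : S) : ¬ Relation.Comp (pairRel u v) (pairRel s t) x z := by
  simp only [Relation.Comp, pairRel_iff]
  rintro ⟨y, ⟨m, h1, h2, rfl, rfl⟩, n, h3, h4, h5, rfl⟩
  have : u * m ∈ {x | ∃ w, x = t * w} ∩ {x | ∃ w, x = u * w} := ⟨⟨n, h5⟩, m, rfl⟩
  rw [hr.1] at this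
  obtain ⟨k, hk⟩ := this
  exact h2 (by rw [hk, zero_mul])

theorem InHull.exists_eq_pairRel {S : Type*} [SemigroupWithZero S]
    (hcat : ∀ r s t : S, r * s ≠ 0 → s * t ≠ 0 → r * (s * t) ≠ 0)
    (hlc : ZeroLeftCancellative S)
    (hrlu : ∀ s : S, ∃ e : S, e * e = e ∧ s * e = s)
    (hlcm : ∀ s t : S, ∃ r : S, IsLCM s t r)
    {g : S → S → Prop} (hg : InHull (theta (S := S)) g) (hne : ∃ x y : S, g x y) :
    ∃ s t e : S, s ≠ 0 ∧ t ≠ 0 ∧ e * e = e ∧ s * e = s ∧ t * e = t ∧ g = _root_.pairRel s t := by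
  induction hg with
  | base s =>
    obtain ⟨x, y, -, hsx, -⟩ := hne
    obtain ⟨e, he, hse⟩ := hrlu s
    have hs : s ≠ 0 := left_ne_zero_of_mul hsx
    have he0 : e ≠ 0 := right_ne_zero_of_mul (hse.symm ▸ hs : s * e ≠ 0)
    exact ⟨s, e, e, hs, he0, he, hse, he, theta_eq_pairRel hlc he hse⟩
  | inv _ ih =>
    obtain ⟨x, y, hxy⟩ := hne
    obtain ⟨s, t, e, hs, ht, he, hse, hte, rfl⟩ := ih ⟨y, x, hxy⟩
    exact ⟨t, s, e, ht, hs, he, hte, hse, flip_pairRel s t⟩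
  | comp _ _ ih₁ ih₂ =>
    obtain ⟨x, z, hxz⟩ := hne
    obtain ⟨y, hxy, hyz⟩ := id hxz
    obtain ⟨u, v, d, hu, hv, -, hud, hvd, rfl⟩ := ih₁ ⟨x, y, hxy⟩
    obtain ⟨s, t, e, hs, ht, -, hse, hte, rfl⟩ := ih₂ ⟨y, z, hyz⟩
    obtain ⟨r, hr⟩ := hlcm t u
    have hr0 : r ≠ 0 := by
      rintro rfl
      exact not_comp_pairRel_of_isLCM_zero hr x z hxz
    obtain ⟨⟨p, hp⟩, q, hq⟩ := hr.exists_mul_eq hrlu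
    obtain ⟨f, hf, hrf⟩ := hrlu r
    have hpf : p * f = p :=
      (hlc t p (p * f) (by rw [← mul_assoc, hp, hrf]) (hp ▸ hr0)).symm
    have hqf : q * f = q :=
      (hlc u q (q * f) (by rw [← mul_assoc, hq, hrf]) (hq ▸ hr0)).symm
    refine ⟨s * p, v * q, f, ?_, ?_, hf, ?_, ?_, comp_pairRel hcat hlc hr hr0 hp hq⟩
    · exact hlc.mul_ne_zero_of_unit hcat hs hse hte (hp ▸ hr0)
    · exact hlc.mul_ne_zero_of_unit hcat hv hvd hud (hq ▸ hr0)
    · rw [mul_assoc, hpf]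
    · rw [mul_assoc, hqf]

theorem pairRel_le_of_mul_eq {S : Type*} [SemigroupWithZero S] {s₁ t₁ s₂ t₂ y : S}
    (hs : s₂ * y = s₁) (ht : t₂ * y = t₁) {a b : S} (h : pairRel s₁ t₁ a b) :
    pairRel s₂ t₂ a b := by
  subst hs ht
  obtain ⟨m, h1, h2, rfl, rfl⟩ := pairRel_iff.1 h
  rw [mul_assoc] at h1 h2
  exact pairRel_iff.2 ⟨y * m, h1, h2, mul_assoc _ _ _, mul_assoc _ _ _⟩

/-- For a categorical at zero, `0`-left cancellative, right reductive semigroup with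
right local units and least common multiples, the nonzero elements of the inverse hull
are exactly the `θ_s θ_t⁻¹` with `s⁺ = t⁺` (witnessed by a common idempotent `e` with
`s*e = s` and `t*e = t`), and `θ_{s₁}θ_{t₁}⁻¹ = θ_{s₂}θ_{t₂}⁻¹` iff suitable `x, y`
exist. -/
theorem inverseHull.catAtZeroHull {S : Type*} [SemigroupWithZero S]
    (hcat : ∀ r s t : S, r * s ≠ 0 → s * t ≠ 0 → r * (s * t) ≠ 0)
    (hlc : ZeroLeftCancellative S)
    (hrr : RightReductive S)
    (hrlu : ∀ s : S, ∃ e : S, e * e = e ∧ s * e = s)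
    (hlcm : ∀ s t : S, ∃ r : S, IsLCM s t r) :
    (∀ g : S → S → Prop,
      (InHull (theta (S := S)) g ∧ ∃ x y : S, g x y) ↔
        ∃ s t e : S, s ≠ 0 ∧ t ≠ 0 ∧ e * e = e ∧ s * e = s ∧ t * e = t ∧
          g = pairRel s t) ∧
    (∀ s₁ t₁ s₂ t₂ e₁ e₂ : S, s₁ ≠ 0 → t₁ ≠ 0 → s₂ ≠ 0 → t₂ ≠ 0 →
      e₁ * e₁ = e₁ → s₁ * e₁ = s₁ → t₁ * e₁ = t₁ →
      e₂ * e₂ = e₂ → s₂ * e₂ = s₂ → t₂ * e₂ = t₂ →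
      (pairRel s₁ t₁ = pairRel s₂ t₂ ↔
        ∃ x y : S, x * y = e₁ ∧ y * x = e₂ ∧ s₁ * x = s₂ ∧ t₁ * x = t₂ ∧
          s₂ * y = s₁ ∧ t₂ * y = t₁)) := by
  refine ⟨fun g => ⟨fun ⟨hg, hne⟩ => hg.exists_eq_pairRel hcat hlc hrlu hlcm hne, ?_⟩, ?_⟩
  · rintro ⟨s, t, e, hs, ht, -, hse, hte, rfl⟩
    exact ⟨.pairRel s t, t, s, pairRel_self_apply hs ht hse hte⟩
  · intro s₁ t₁ s₂ t₂ e₁ e₂ hs₁ ht₁ hs₂ ht₂ _ hse₁ hte₁ _ hse₂ hte₂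
    constructor
    · intro h
      have h₁ := pairRel_self_apply hs₁ ht₁ hse₁ hte₁
      have h₂ := pairRel_self_apply hs₂ ht₂ hse₂ hte₂
      rw [h] at h₁
      rw [← h] at h₂
      obtain ⟨y, -, -, hty, hsy⟩ := pairRel_iff.1 h₁
      obtain ⟨x, -, -, htx, hsx⟩ := pairRel_iff.1 h₂
      refine ⟨x, y, ?_, ?_, hsx.symm, htx.symm, hsy.symm, hty.symm⟩
      · have hxy : s₁ * (x * y) = s₁ := by rw [← mul_assoc, ← hsx, ← hsy]
        exact hlc s₁ _ _ (hxy.trans hse₁.symm) (by rwa [hxy])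
      · have hyx : s₂ * (y * x) = s₂ := by rw [← mul_assoc, ← hsy, ← hsx]
        exact hlc s₂ _ _ (hyx.trans hse₂.symm) (by rwa [hyx])
    · rintro ⟨x, y, -, -, hsx, htx, hsy, hty⟩
      ext a b
      exact ⟨pairRel_le_of_mul_eq hsy hty, pairRel_le_of_mul_eq hsx htx⟩
end

section
/- Let M and N be non-trivial 0-left cancellative monoids with zero. Then their 0-free product M ∗₀ N is 0-left cancellative. Dually, if M and N are non-trivial 0-right cancellative monoids with zero, then M ∗₀ N is 0-right cancellative. -/
open Monoid

/-- Membership in the two-sided ideal of the free product `M ∗ N` generated by the zero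
elements of `M` and `N`. -/
def InZeroIdeal (M N : Type*) [Monoid M] [Monoid N] [Zero M] [Zero N]
    (x : Coprod M N) : Prop :=
  ∃ a b : Coprod M N,
    x = a * Coprod.inl (0 : M) * b ∨ x = a * Coprod.inr (0 : N) * b

/-- The Rees congruence on `M ∗ N` identifying the ideal generated by the zeros of `M`
and `N` to a single element. -/
def reesCon (M N : Type*) [Monoid M] [Monoid N] [Zero M] [Zero N] :
    Con (Coprod M N) :=
  conGen (fun x y => InZeroIdeal M N x ∧ InZeroIdeal M N y)

/-- The `0`-free product `M ∗₀ N` of two monoids with zero: the Rees quotient of the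
free product of monoids `M ∗ N` by the ideal generated by the zero elements. -/
def ZeroFreeProd (M N : Type*) [Monoid M] [Monoid N] [Zero M] [Zero N] :=
  (reesCon M N).Quotient

instance ZeroFreeProd.instMonoid (M N : Type*) [Monoid M] [Monoid N] [Zero M] [Zero N] :
    Monoid (ZeroFreeProd M N) :=
  inferInstanceAs (Monoid (reesCon M N).Quotient)

/-- The zero element of `M ∗₀ N`, namely the class of the ideal generated by the zeros. -/
def ZeroFreeProd.zero (M N : Type*) [Monoid M] [Monoid N] [Zero M] [Zero N] :
    ZeroFreeProd M N :=
  (reesCon M N).mk' (Coprod.inl (0 : M))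

section CoprodI

variable {ι : Type*} {M : ι → Type*} [∀ i, MonoidWithZero (M i)]

/-- Membership in the two-sided ideal of a free product generated by the zeros of its factors. -/
def CoprodI.MemZeroIdeal (x : CoprodI M) : Prop :=
  ∃ (i : ι) (a b : CoprodI M), x = a * CoprodI.of (0 : M i) * b

lemma CoprodI.MemZeroIdeal.mul_left {x : CoprodI M} (h : CoprodI.MemZeroIdeal x)
    (c : CoprodI M) : CoprodI.MemZeroIdeal (c * x) := by
  obtain ⟨i, a, b, rfl⟩ := h
  exact ⟨i, c * a, b, by simp only [mul_assoc]⟩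

lemma CoprodI.of_mul_left_cancel {i : ι}
    (h : ∀ s t r : M i, s * t = s * r → s * t ≠ 0 → t = r) (m : M i) {x y : CoprodI M}
    (hxy : CoprodI.of m * x = CoprodI.of m * y)
    (hx : ¬ CoprodI.MemZeroIdeal (CoprodI.of m * x)) : x = y := by
  classical
  obtain ⟨u, rfl⟩ := CoprodI.Word.equiv.symm.surjective x
  obtain ⟨v, rfl⟩ := CoprodI.Word.equiv.symm.surjective y
  have key : CoprodI.of m • u = CoprodI.of m • v := by
    apply CoprodI.Word.equiv.symm.injective
    change CoprodI.Word.prod _ = CoprodI.Word.prod _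
    rw [CoprodI.Word.prod_smul, CoprodI.Word.prod_smul]
    exact hxy
  have hpair := congrArg (CoprodI.Word.equivPair i) key
  rw [CoprodI.Word.equivPair_smul_same, CoprodI.Word.equivPair_smul_same,
    CoprodI.Word.Pair.mk.injEq] at hpair
  obtain ⟨hhead, htail⟩ := hpair
  have hne : m * (CoprodI.Word.equivPair i u).head ≠ 0 := by
    intro h0
    refine hx ⟨i, 1, (CoprodI.Word.equivPair i u).tail.prod, ?_⟩
    change _ * CoprodI.Word.prod u = _
    conv_lhs => rw [← CoprodI.Word.equivPair_head_smul_equivPair_tail (i := i) u]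
    rw [CoprodI.Word.prod_smul, ← mul_assoc, ← map_mul, h0, one_mul]
  congr 1
  apply (CoprodI.Word.equivPair i).injective
  exact CoprodI.Word.Pair.ext (h _ _ _ hhead hne) htail

lemma CoprodI.mul_left_cancel_of_not_inZeroIdeal
    (h : ∀ i, ∀ s t r : M i, s * t = s * r → s * t ≠ 0 → t = r) (s : CoprodI M)
    {t r : CoprodI M} (htr : s * t = s * r) (hst : ¬ CoprodI.MemZeroIdeal (s * t)) : t = r := by
  induction s using CoprodI.induction_left with
  | one => simpa using htr
  | mul m x ih =>
    rw [mul_assoc] at hst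
    rw [mul_assoc, mul_assoc] at htr
    exact ih (CoprodI.of_mul_left_cancel (h _) m htr hst) fun hx => hst (hx.mul_left _)

end CoprodI

universe u v

/-- The two factors of a binary free product as a family indexed by `Bool`. -/
def BoolFamily (M : Type u) (N : Type v) : Bool → Type (max u v)
  | true => ULift.{v} M
  | false => ULift.{u} N

instance BoolFamily.instMonoidWithZero (M : Type u) (N : Type v)
    [MonoidWithZero M] [MonoidWithZero N] : ∀ b, MonoidWithZero (BoolFamily M N b)
  | true => inferInstanceAs (MonoidWithZero (ULift.{v} M))
  | false => inferInstanceAs (MonoidWithZero (ULift.{u} N))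

section Coprod

variable {M : Type u} {N : Type v} [MonoidWithZero M] [MonoidWithZero N]

/-- The canonical map from the binary free product to the indexed free product. -/
def Coprod.toCoprodI : Coprod M N →* CoprodI (BoolFamily M N) :=
  Coprod.lift
    ((CoprodI.of (M := BoolFamily M N) (i := true)).comp
      (MulEquiv.ulift (α := M)).symm.toMonoidHom)
    ((CoprodI.of (M := BoolFamily M N) (i := false)).comp
      (MulEquiv.ulift (α := N)).symm.toMonoidHom)

/-- The inclusions of the two factors in the binary free product. -/
def BoolFamily.toCoprod : ∀ b, BoolFamily M N b →* Coprod M N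
  | true => Coprod.inl.comp (MulEquiv.ulift (α := M)).toMonoidHom
  | false => Coprod.inr.comp (MulEquiv.ulift (α := N)).toMonoidHom

/-- The canonical map from the indexed free product to the binary free product. -/
def Coprod.ofCoprodI : CoprodI (BoolFamily M N) →* Coprod M N :=
  CoprodI.lift BoolFamily.toCoprod

lemma Coprod.ofCoprodI_toCoprodI (x : Coprod M N) :
    Coprod.ofCoprodI (Coprod.toCoprodI x) = x := by
  have : (Coprod.ofCoprodI (M := M) (N := N)).comp Coprod.toCoprodI = MonoidHom.id _ := by
    apply Coprod.hom_ext <;> ext x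
    · exact CoprodI.lift_of (M := BoolFamily M N) BoolFamily.toCoprod (i := true) (ULift.up x)
    · exact CoprodI.lift_of (M := BoolFamily M N) BoolFamily.toCoprod (i := false) (ULift.up x)
  exact DFunLike.congr_fun this x

lemma CoprodI.MemZeroIdeal.ofCoprodI {x : CoprodI (BoolFamily M N)}
    (h : CoprodI.MemZeroIdeal x) : InZeroIdeal M N (Coprod.ofCoprodI x) := by
  obtain ⟨_ | _, a, b, rfl⟩ := h <;>
    refine ⟨Coprod.ofCoprodI a, Coprod.ofCoprodI b, ?_⟩
  · right
    simp only [map_mul, Coprod.ofCoprodI, CoprodI.lift_of]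
    rfl
  · left
    simp only [map_mul, Coprod.ofCoprodI, CoprodI.lift_of]
    rfl

lemma Coprod.mul_left_cancel_of_not_inZeroIdeal
    (hM : ∀ s t r : M, s * t = s * r → s * t ≠ 0 → t = r)
    (hN : ∀ s t r : N, s * t = s * r → s * t ≠ 0 → t = r) {s t r : Coprod M N}
    (htr : s * t = s * r) (hst : ¬ InZeroIdeal M N (s * t)) : t = r := by
  have hF : ∀ b, ∀ s t r : BoolFamily M N b, s * t = s * r → s * t ≠ 0 → t = r := by
    rintro (_ | _) s t r h h0
    · exact ULift.ext _ _ (hN s.down t.down r.down (congrArg ULift.down h)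
        fun h' => h0 (ULift.ext _ _ h'))
    · exact ULift.ext _ _ (hM s.down t.down r.down (congrArg ULift.down h)
        fun h' => h0 (ULift.ext _ _ h'))
  apply Function.LeftInverse.injective Coprod.ofCoprodI_toCoprodI
  refine CoprodI.mul_left_cancel_of_not_inZeroIdeal hF (Coprod.toCoprodI s) ?_ fun h => hst ?_
  · rw [← map_mul, htr, map_mul]
  · rw [← map_mul] at h
    simpa only [Coprod.ofCoprodI_toCoprodI] using h.ofCoprodI

/-- Reversal of words, as a map to the opposite of the free product of the opposites. -/
def Coprod.reverse : Coprod M N →* (Coprod Mᵐᵒᵖ Nᵐᵒᵖ)ᵐᵒᵖ :=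
  Coprod.lift
    ((MonoidHom.op (Coprod.inl : Mᵐᵒᵖ →* Coprod Mᵐᵒᵖ Nᵐᵒᵖ)).comp (MulEquiv.opOp M).toMonoidHom)
    ((MonoidHom.op (Coprod.inr : Nᵐᵒᵖ →* Coprod Mᵐᵒᵖ Nᵐᵒᵖ)).comp (MulEquiv.opOp N).toMonoidHom)

/-- Reversal of words, from the free product of the opposites. -/
def Coprod.unreverse : Coprod Mᵐᵒᵖ Nᵐᵒᵖ →* (Coprod M N)ᵐᵒᵖ :=
  Coprod.lift (MonoidHom.op Coprod.inl) (MonoidHom.op Coprod.inr)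

lemma Coprod.unreverse_reverse (x : Coprod M N) :
    (Coprod.unreverse (Coprod.reverse x).unop).unop = x := by
  induction x using Coprod.induction_on with
  | inl m => rfl
  | inr n => rfl
  | mul x y hx hy => simp only [map_mul, MulOpposite.unop_mul, hx, hy]

lemma InZeroIdeal.unreverse {x : Coprod Mᵐᵒᵖ Nᵐᵒᵖ} (h : InZeroIdeal Mᵐᵒᵖ Nᵐᵒᵖ x) :
    InZeroIdeal M N (Coprod.unreverse x).unop := by
  obtain ⟨a, b, h⟩ := h
  refine ⟨(Coprod.unreverse b).unop, (Coprod.unreverse a).unop, h.imp ?_ ?_⟩ <;>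
  · rintro rfl
    simp only [map_mul, MulOpposite.unop_mul, mul_assoc]
    rfl

lemma Coprod.mul_right_cancel_of_not_inZeroIdeal
    (hM : ∀ t r s : M, t * s = r * s → t * s ≠ 0 → t = r)
    (hN : ∀ t r s : N, t * s = r * s → t * s ≠ 0 → t = r) {t r s : Coprod M N}
    (htr : t * s = r * s) (hts : ¬ InZeroIdeal M N (t * s)) : t = r := by
  apply Function.LeftInverse.injective
    (g := fun x => (Coprod.unreverse (MulOpposite.unop x)).unop) Coprod.unreverse_reverse
  apply MulOpposite.unop_injective
  refine Coprod.mul_left_cancel_of_not_inZeroIdeal (s := (Coprod.reverse s).unop) ?_ ?_ ?_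
    fun h => hts ?_
  · exact fun s t r h h0 => MulOpposite.unop_injective (hM _ _ _ (congrArg MulOpposite.unop h)
      fun h' => h0 (MulOpposite.unop_injective h'))
  · exact fun s t r h h0 => MulOpposite.unop_injective (hN _ _ _ (congrArg MulOpposite.unop h)
      fun h' => h0 (MulOpposite.unop_injective h'))
  · rw [← MulOpposite.unop_mul, ← MulOpposite.unop_mul, ← map_mul, ← map_mul, htr]
  · rw [← MulOpposite.unop_mul, ← map_mul] at h
    simpa only [Coprod.unreverse_reverse] using h.unreverse

lemma InZeroIdeal.mul_left {x : Coprod M N} (h : InZeroIdeal M N x) (c : Coprod M N) :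
    InZeroIdeal M N (c * x) := by
  obtain ⟨a, b, h⟩ := h
  exact ⟨c * a, b, h.imp (by rintro rfl; simp only [mul_assoc])
    (by rintro rfl; simp only [mul_assoc])⟩

lemma InZeroIdeal.mul_right {x : Coprod M N} (h : InZeroIdeal M N x) (c : Coprod M N) :
    InZeroIdeal M N (x * c) := by
  obtain ⟨a, b, h⟩ := h
  exact ⟨a, b * c, h.imp (by rintro rfl; simp only [mul_assoc])
    (by rintro rfl; simp only [mul_assoc])⟩

lemma inZeroIdeal_inl_zero : InZeroIdeal M N (Coprod.inl 0) :=
  ⟨1, 1, Or.inl (by simp)⟩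

lemma reesCon_iff {x y : Coprod M N} :
    reesCon M N x y ↔ x = y ∨ InZeroIdeal M N x ∧ InZeroIdeal M N y := by
  refine ⟨fun h => ?_, ?_⟩
  · change ConGen.Rel _ x y at h
    induction h with
    | of x y h => exact Or.inr h
    | refl x => exact Or.inl rfl
    | symm _ ih => exact ih.imp Eq.symm And.symm
    | trans _ _ ih₁ ih₂ =>
      obtain rfl | h₁ := ih₁
      · exact ih₂
      obtain rfl | h₂ := ih₂
      · exact Or.inr h₁
      · exact Or.inr ⟨h₁.1, h₂.2⟩
    | mul _ _ ih₁ ih₂ =>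
      obtain rfl | h₁ := ih₁
      · obtain rfl | h₂ := ih₂
        · exact Or.inl rfl
        · exact Or.inr ⟨h₂.1.mul_left _, h₂.2.mul_left _⟩
      · exact Or.inr ⟨h₁.1.mul_right _, h₁.2.mul_right _⟩
  · rintro (rfl | h)
    · exact (reesCon M N).refl x
    · exact ConGen.Rel.of _ _ h

lemma ZeroFreeProd.eq_of_mk_eq_of_ne_zero {x y : Coprod M N}
    (hxy : (reesCon M N).mk' x = (reesCon M N).mk' y)
    (hx : (reesCon M N).mk' x ≠ ZeroFreeProd.zero M N) :
    x = y ∧ ¬ InZeroIdeal M N x := by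
  have hx' : ¬ InZeroIdeal M N x := fun h =>
    hx ((Con.eq _).2 (reesCon_iff.2 (Or.inr ⟨h, inZeroIdeal_inl_zero⟩)))
  exact ⟨(reesCon_iff.1 ((Con.eq _).1 hxy)).resolve_right fun h => hx' h.1, hx'⟩

end Coprod

/-- The `0`-free product of non-trivial `0`-left cancellative monoids with zero is
`0`-left cancellative, and dually the `0`-free product of non-trivial `0`-right
cancellative monoids with zero is `0`-right cancellative. -/
theorem zeroFreeProd.cancellative (M N : Type*) [MonoidWithZero M] [MonoidWithZero N]
    (hM : ∃ m : M, m ≠ 0 ∧ m ≠ 1) (hN : ∃ n : N, n ≠ 0 ∧ n ≠ 1) :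
    (((∀ s t r : M, s * t = s * r → s * t ≠ 0 → t = r) ∧
      (∀ s t r : N, s * t = s * r → s * t ≠ 0 → t = r)) →
        ∀ s t r : ZeroFreeProd M N,
          s * t = s * r → s * t ≠ ZeroFreeProd.zero M N → t = r) ∧
    (((∀ t r s : M, t * s = r * s → t * s ≠ 0 → t = r) ∧
      (∀ t r s : N, t * s = r * s → t * s ≠ 0 → t = r)) →
        ∀ t r s : ZeroFreeProd M N,
          t * s = r * s → t * s ≠ ZeroFreeProd.zero M N → t = r) := by
  refine ⟨fun h s t r hst h0 => ?_, fun h t r s hts h0 => ?_⟩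
  · obtain ⟨s, rfl⟩ := (reesCon M N).mk'_surjective s
    obtain ⟨t, rfl⟩ := (reesCon M N).mk'_surjective t
    obtain ⟨r, rfl⟩ := (reesCon M N).mk'_surjective r
    obtain ⟨heq, hne⟩ :=
      ZeroFreeProd.eq_of_mk_eq_of_ne_zero (x := s * t) (y := s * r) hst h0
    exact congrArg _ (Coprod.mul_left_cancel_of_not_inZeroIdeal h.1 h.2 heq hne)
  · obtain ⟨s, rfl⟩ := (reesCon M N).mk'_surjective s
    obtain ⟨t, rfl⟩ := (reesCon M N).mk'_surjective t
    obtain ⟨r, rfl⟩ := (reesCon M N).mk'_surjective r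
    obtain ⟨heq, hne⟩ :=
      ZeroFreeProd.eq_of_mk_eq_of_ne_zero (x := t * s) (y := r * s) hts h0
    exact congrArg _ (Coprod.mul_right_cancel_of_not_inZeroIdeal h.1 h.2 heq hne)
end

section
/- Let S be a 0-left cancellative semigroup with zero. (i) For each r ∈ S, the map θ⋆_r : F⋆_r → E⋆_r, σ ↦ r∗σ, is a well-defined bijection whose inverse sends σ ∈ E⋆_r to r^{-1}∗σ := {t ∈ S : rt ∈ σ}, which is again a string. (ii) Viewing each θ⋆_r as a partial bijection of S^⋆, the map r ↦ θ⋆_r is a representation of S on S^⋆: θ⋆_0 is the empty map and θ⋆_{r_1} ∘ θ⋆_{r_2} = θ⋆_{r_1 r_2} for all r_1, r_2 ∈ S. -/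
/-- A string in `S`: a nonempty subset not containing `0`, closed under divisors,
and directed with respect to divisibility. -/
def IsString {S : Type*} [SemigroupWithZero S] (σ : Set S) : Prop :=
  σ.Nonempty ∧ (0 : S) ∉ σ ∧
  (∀ s t : S, Divides s t → t ∈ σ → s ∈ σ) ∧
  (∀ s₁ ∈ σ, ∀ s₂ ∈ σ, ∃ s ∈ σ, Divides s₁ s ∧ Divides s₂ s)

/-- `r ∗ σ`, the set of divisors of elements of `rσ`. -/
def star {S : Type*} [SemigroupWithZero S] (r : S) (σ : Set S) : Set S :=
  {t | ∃ s ∈ σ, Divides t (r * s)}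

/-- `r⁻¹ ∗ σ = {t ∈ S : rt ∈ σ}`. -/
def starInv {S : Type*} [SemigroupWithZero S] (r : S) (σ : Set S) : Set S :=
  {t | r * t ∈ σ}

/-- `F⋆_r`, the domain of `θ⋆_r`: the strings `σ` with `0 ∉ rσ`. -/
def Fstar {S : Type*} [SemigroupWithZero S] (r : S) : Set (Set S) :=
  {σ | IsString σ ∧ ∀ s ∈ σ, r * s ≠ 0}

/-- `E⋆_r`, the range of `θ⋆_r`: the strings `σ` with `σ ∩ rS ≠ ∅`. -/
def Estar {S : Type*} [SemigroupWithZero S] (r : S) : Set (Set S) :=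
  {σ | IsString σ ∧ ∃ t ∈ σ, ∃ x, t = r * x}

theorem Divides.refl {S : Type*} [Mul S] (s : S) : Divides s s := Or.inl rfl

theorem Divides.trans {S : Type*} [Semigroup S] {a b c : S}
    (hab : Divides a b) (hbc : Divides b c) : Divides a c := by
  rcases hab with rfl | ⟨u, rfl⟩
  · exact hbc
  · rcases hbc with rfl | ⟨v, rfl⟩
    · exact Or.inr ⟨u, rfl⟩
    · exact Or.inr ⟨u * v, (mul_assoc a u v).symm⟩

theorem Divides.mul_left {S : Type*} [Semigroup S] {a b : S} (r : S)
    (h : Divides a b) : Divides (r * a) (r * b) := by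
  rcases h with rfl | ⟨u, rfl⟩
  · exact Divides.refl _
  · exact Or.inr ⟨u, mul_assoc r a u⟩

theorem Divides.eq_zero {S : Type*} [SemigroupWithZero S] {a : S}
    (h : Divides 0 a) : a = 0 := by
  rcases h with h | ⟨u, h⟩
  · exact h
  · rw [← h, zero_mul]

/-- Every multiple of `r * a` is of the form `r * w` with `w` a multiple of `a`. -/
theorem Divides.exists_eq_mul {S : Type*} [Semigroup S] {r a b : S}
    (h : Divides (r * a) b) : ∃ w, b = r * w ∧ Divides a w := by
  rcases h with rfl | ⟨u, rfl⟩
  · exact ⟨a, rfl, Divides.refl a⟩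
  · exact ⟨a * u, mul_assoc r a u, Or.inr ⟨u, rfl⟩⟩

theorem ZeroLeftCancellative.divides_of_mul_left {S : Type*} [SemigroupWithZero S]
    (hlc : ZeroLeftCancellative S) {r a b : S} (h : Divides (r * a) (r * b))
    (hb : r * b ≠ 0) : Divides a b := by
  obtain ⟨w, hw, haw⟩ := h.exists_eq_mul
  rwa [hlc r b w hw hb]

theorem mul_mem_star {S : Type*} [SemigroupWithZero S] {r s : S} {σ : Set S}
    (hs : s ∈ σ) : r * s ∈ star r σ :=
  ⟨s, hs, Divides.refl _⟩

theorem isString_star {S : Type*} [SemigroupWithZero S] {r : S} {σ : Set S}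
    (h : σ ∈ Fstar r) : IsString (star r σ) := by
  obtain ⟨⟨⟨s, hs⟩, -, -, hdir⟩, hne⟩ := h
  refine ⟨⟨r * s, mul_mem_star hs⟩, ?_, ?_, ?_⟩
  · rintro ⟨t, ht, h0⟩
    exact hne t ht h0.eq_zero
  · rintro a b hab ⟨t, ht, hbt⟩
    exact ⟨t, ht, hab.trans hbt⟩
  · rintro a ⟨s₁, hs₁, ha⟩ b ⟨s₂, hs₂, hb⟩
    obtain ⟨t, ht, h₁, h₂⟩ := hdir s₁ hs₁ s₂ hs₂
    exact ⟨r * t, mul_mem_star ht, ha.trans (h₁.mul_left r), hb.trans (h₂.mul_left r)⟩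

theorem star_mem_Estar {S : Type*} [SemigroupWithZero S] {r : S} {σ : Set S}
    (h : σ ∈ Fstar r) : star r σ ∈ Estar r := by
  obtain ⟨s, hs⟩ := h.1.1
  exact ⟨isString_star h, r * s, mul_mem_star hs, s, rfl⟩

theorem starInv_star {S : Type*} [SemigroupWithZero S] (hlc : ZeroLeftCancellative S)
    {r : S} {σ : Set S} (h : σ ∈ Fstar r) : starInv r (star r σ) = σ := by
  apply Set.Subset.antisymm
  · rintro t ⟨s, hs, hts⟩
    exact h.1.2.2.1 t s (hlc.divides_of_mul_left hts (h.2 s hs)) hs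
  · exact fun t ht => mul_mem_star ht

theorem starInv_mem_Fstar {S : Type*} [SemigroupWithZero S] (hlc : ZeroLeftCancellative S)
    {r : S} {σ : Set S} (h : σ ∈ Estar r) : starInv r σ ∈ Fstar r := by
  obtain ⟨⟨-, h0, hdiv, hdir⟩, _, hx, x, rfl⟩ := h
  have hne : ∀ s ∈ starInv r σ, r * s ≠ 0 := fun s hs hs0 => h0 (hs0 ▸ hs)
  refine ⟨⟨⟨x, hx⟩, fun hz => hne 0 hz (mul_zero r), ?_, ?_⟩, hne⟩
  · exact fun a b hab hb => hdiv _ _ (hab.mul_left r) hb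
  · intro a ha b hb
    obtain ⟨s, hs, has, hbs⟩ := hdir _ ha _ hb
    obtain ⟨w, rfl, haw⟩ := has.exists_eq_mul
    exact ⟨w, hs, haw, hlc.divides_of_mul_left hbs (hne w hs)⟩

theorem star_starInv {S : Type*} [SemigroupWithZero S] {r : S} {σ : Set S}
    (h : σ ∈ Estar r) : star r (starInv r σ) = σ := by
  obtain ⟨⟨-, -, hdiv, hdir⟩, _, hx, x, rfl⟩ := h
  apply Set.Subset.antisymm
  · rintro t ⟨s, hs, hts⟩
    exact hdiv _ _ hts hs
  · intro t ht
    obtain ⟨s, hs, hts, hxs⟩ := hdir _ ht _ hx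
    obtain ⟨w, rfl, -⟩ := hxs.exists_eq_mul
    exact ⟨w, hs, hts⟩

theorem notMem_Fstar_zero {S : Type*} [SemigroupWithZero S] (σ : Set S) :
    σ ∉ Fstar (0 : S) := by
  rintro ⟨⟨⟨s, hs⟩, -⟩, hne⟩
  exact hne s hs (zero_mul s)

theorem notMem_Estar_zero {S : Type*} [SemigroupWithZero S] (σ : Set S) :
    σ ∉ Estar (0 : S) := by
  rintro ⟨⟨-, h0, -⟩, t, ht, x, rfl⟩
  exact h0 (zero_mul x ▸ ht)

theorem mem_Fstar_mul_iff {S : Type*} [SemigroupWithZero S] {r₁ r₂ : S} {σ : Set S} :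
    (σ ∈ Fstar r₂ ∧ star r₂ σ ∈ Fstar r₁) ↔ σ ∈ Fstar (r₁ * r₂) := by
  constructor
  · rintro ⟨h₂, h₁⟩
    refine ⟨h₂.1, fun s hs => ?_⟩
    rw [mul_assoc]
    exact h₁.2 _ (mul_mem_star hs)
  · rintro ⟨hσ, hne⟩
    have h₂ : σ ∈ Fstar r₂ := by
      refine ⟨hσ, fun s hs h0 => hne s hs ?_⟩
      rw [mul_assoc, h0, mul_zero]
    refine ⟨h₂, isString_star h₂, ?_⟩
    rintro t ⟨s, hs, hts⟩ h0
    have hd := hts.mul_left r₁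
    rw [h0, ← mul_assoc] at hd
    exact hne s hs hd.eq_zero

theorem star_star_eq_star_mul {S : Type*} [SemigroupWithZero S] (r₁ r₂ : S) (σ : Set S) :
    star r₁ (star r₂ σ) = star (r₁ * r₂) σ := by
  apply Set.Subset.antisymm
  · rintro t ⟨u, ⟨s, hs, hus⟩, htu⟩
    refine ⟨s, hs, ?_⟩
    rw [mul_assoc]
    exact htu.trans (hus.mul_left r₁)
  · rintro t ⟨s, hs, hts⟩
    rw [mul_assoc] at hts
    exact ⟨r₂ * s, mul_mem_star hs, hts⟩

/-- `θ⋆ : r ↦ (θ⋆_r : F⋆_r → E⋆_r, σ ↦ r∗σ)` is a well-defined representation of `S`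
on the set `S⋆` of strings by partial bijections:  `θ⋆_r` maps `F⋆_r` bijectively onto
`E⋆_r` with inverse `σ ↦ r⁻¹∗σ`, `θ⋆_0` is the empty map, and
`θ⋆_{r₁} ∘ θ⋆_{r₂} = θ⋆_{r₁ r₂}`. -/
theorem strings.starRepresentation {S : Type*} [SemigroupWithZero S]
    (hlc : ZeroLeftCancellative S) :
    (∀ r : S, ∀ σ : Set S, σ ∈ Fstar r →
      star r σ ∈ Estar r ∧ starInv r (star r σ) = σ) ∧
    (∀ r : S, ∀ σ : Set S, σ ∈ Estar r →
      starInv r σ ∈ Fstar r ∧ star r (starInv r σ) = σ) ∧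
    (∀ σ : Set S, σ ∉ Fstar (0 : S) ∧ σ ∉ Estar (0 : S)) ∧
    (∀ r₁ r₂ : S, ∀ σ : Set S,
      (σ ∈ Fstar r₂ ∧ star r₂ σ ∈ Fstar r₁) ↔ σ ∈ Fstar (r₁ * r₂)) ∧
    (∀ r₁ r₂ : S, ∀ σ : Set S, σ ∈ Fstar (r₁ * r₂) →
      star r₁ (star r₂ σ) = star (r₁ * r₂) σ) := by
  exact ⟨fun r σ h => ⟨star_mem_Estar h, starInv_star hlc h⟩,
    fun r σ h => ⟨starInv_mem_Fstar hlc h, star_starInv h⟩,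
    fun σ => ⟨notMem_Fstar_zero σ, notMem_Estar_zero σ⟩,
    fun _ _ _ => mem_Fstar_mul_iff,
    fun r₁ r₂ σ _ => star_star_eq_star_mul r₁ r₂ σ⟩
end

section
/- Let X be a set equipped with a transitive and reflexive relation ≤, and let I₊(X) be the set of partial bijections φ of X whose domain F_φ and range E_φ are convex and which are order preserving (x ≤ y iff φ(x) ≤ φ(y), for x,y ∈ F_φ). Then I₊(X) is an inverse subsemigroup of the symmetric inverse semigroup I(X), and the map φ ↦ φ^Σ, where φ^Σ is the partial bijection of Σ(X) with domain F^Σ_φ = {σ ∈ Σ(X) : σ ⊑ F_φ}, range E^Σ_φ = {σ ∈ Σ(X) : σ ⊑ E_φ}, and φ^Σ(σ) = h(φ(F_φ ∩ σ)), is a semigroup homomorphism I₊(X) → I(Σ(X)); in particular each φ^Σ is a bijection from F^Σ_φ onto E^Σ_φ with inverse (φ^{-1})^Σ. -/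
/-- A partial bijection on `α`, modelled by its graph: a functional and injective
relation. -/
def IsPB {α : Type*} (r : α → α → Prop) : Prop :=
  (∀ ⦃x y y'⦄, r x y → r x y' → y = y') ∧ (∀ ⦃x x' y⦄, r x y → r x' y → x = x')

/-- An element of `I₊(X)`: a partial bijection of the preordered set `X` whose domain
and range are convex, and which is order preserving
(`x ≤ y ↔ φ(x) ≤ φ(y)` for `x, y` in the domain). -/
def OrdPB {X : Type*} [Preorder X] (φ : X → X → Prop) : Prop :=
  IsPB φ ∧
  (∀ ⦃a b c : X⦄, (∃ y, φ a y) → (∃ y, φ c y) → a ≤ b → b ≤ c → ∃ y, φ b y) ∧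
  (∀ ⦃a b c : X⦄, (∃ x, φ x a) → (∃ x, φ x c) → a ≤ b → b ≤ c → ∃ x, φ x b) ∧
  (∀ ⦃x y x' y' : X⦄, φ x x' → φ y y' → (x ≤ y ↔ x' ≤ y'))

/-- The hereditary closure of a subset of a preordered set. -/
def hcl {X : Type*} [Preorder X] (A : Set X) : Set X := {x | ∃ y ∈ A, x ≤ y}

/-- A string in a preordered set: a hereditary directed subset. -/
def IsStringO {X : Type*} [Preorder X] (σ : Set X) : Prop :=
  σ.Nonempty ∧ (∀ ⦃x y : X⦄, y ∈ σ → x ≤ y → x ∈ σ) ∧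
  (∀ x ∈ σ, ∀ y ∈ σ, ∃ z ∈ σ, x ≤ z ∧ y ≤ z)

/-- `D ⊑ E`: the directed set `D` is asymptotically contained in `E`, that is,
`E ∩ D` is cofinal in `D`. -/
def Asymp {X : Type*} [Preorder X] (D E : Set X) : Prop :=
  ∀ x ∈ D, ∃ y, y ∈ E ∩ D ∧ x ≤ y

/-- The partial bijection `φ^Σ` of the set of strings induced by `φ ∈ I₊(X)`:
its domain is `F^Σ_φ = {σ : σ ⊑ F_φ}` and `φ^Σ(σ) = h(φ(F_φ ∩ σ))`. -/
def sigRel {X : Type*} [Preorder X] (φ : X → X → Prop) : Set X → Set X → Prop :=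
  fun σ τ => (IsStringO σ ∧ Asymp σ {x | ∃ y, φ x y}) ∧
    τ = hcl {y | ∃ x ∈ σ, φ x y}

namespace OrdPB

variable {X : Type*} [Preorder X] {φ ψ : X → X → Prop}

theorem inverse (h : OrdPB φ) : OrdPB (flip φ) :=
  ⟨⟨fun _ _ _ h₁ h₂ => h.1.2 h₁ h₂, fun _ _ _ h₁ h₂ => h.1.1 h₁ h₂⟩, h.2.2.1, h.2.1,
    fun _ _ _ _ h₁ h₂ => (h.2.2.2 h₁ h₂).symm⟩

theorem exists_comp_of_le_of_le (hφ : OrdPB φ) (hψ : OrdPB ψ) {a b c : X}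
    (ha : ∃ y, Relation.Comp φ ψ a y) (hc : ∃ y, Relation.Comp φ ψ c y)
    (hab : a ≤ b) (hbc : b ≤ c) : ∃ y, Relation.Comp φ ψ b y := by
  obtain ⟨a₂, a₁, ha₁, ha₂⟩ := ha
  obtain ⟨c₂, c₁, hc₁, hc₂⟩ := hc
  obtain ⟨b₁, hb₁⟩ := hφ.2.1 ⟨a₁, ha₁⟩ ⟨c₁, hc₁⟩ hab hbc
  obtain ⟨b₂, hb₂⟩ := hψ.2.1 ⟨a₂, ha₂⟩ ⟨c₂, hc₂⟩ ((hφ.2.2.2 ha₁ hb₁).1 hab)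
    ((hφ.2.2.2 hb₁ hc₁).1 hbc)
  exact ⟨b₂, b₁, hb₁, hb₂⟩

theorem comp (hφ : OrdPB φ) (hψ : OrdPB ψ) : OrdPB (Relation.Comp φ ψ) := by
  refine ⟨⟨?_, ?_⟩, fun a b c => hφ.exists_comp_of_le_of_le hψ, ?_, ?_⟩
  · rintro x y y' ⟨u, hu, huy⟩ ⟨v, hv, hvy⟩
    obtain rfl := hφ.1.1 hu hv
    exact hψ.1.1 huy hvy
  · rintro x x' y ⟨u, hu, huy⟩ ⟨v, hv, hvy⟩
    obtain rfl := hψ.1.2 huy hvy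
    exact hφ.1.2 hu hv
  · intro a b c ha hc hab hbc
    have := hψ.inverse.exists_comp_of_le_of_le hφ.inverse (a := a) (b := b) (c := c)
    rw [← Relation.flip_comp] at this
    exact this ha hc hab hbc
  · rintro x y x' y' ⟨u, hu, hux⟩ ⟨v, hv, hvy⟩
    exact (hφ.2.2.2 hu hv).trans (hψ.2.2.2 hux hvy)

theorem sigRel_flip_of_sigRel (h : OrdPB φ) {σ τ : Set X} (hστ : sigRel φ σ τ) :
    sigRel (flip φ) τ σ := by
  obtain ⟨⟨⟨⟨x₀, hx₀⟩, hered, dir⟩, asymp⟩, rfl⟩ := hστ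
  refine ⟨⟨⟨?_, ?_, ?_⟩, ?_⟩, ?_⟩
  · obtain ⟨x, ⟨⟨y, hxy⟩, hx⟩, -⟩ := asymp x₀ hx₀
    exact ⟨y, y, ⟨x, hx, hxy⟩, le_rfl⟩
  · rintro u v ⟨y, hy, hvy⟩ huv
    exact ⟨y, hy, huv.trans hvy⟩
  · rintro u ⟨y, ⟨a, ha, hay⟩, huy⟩ v ⟨z, ⟨b, hb, hbz⟩, hvz⟩
    obtain ⟨c, hc, hac, hbc⟩ := dir a ha b hb
    obtain ⟨d, ⟨⟨w, hdw⟩, hd⟩, hcd⟩ := asymp c hc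
    exact ⟨w, ⟨w, ⟨d, hd, hdw⟩, le_rfl⟩, huy.trans ((h.2.2.2 hay hdw).1 (hac.trans hcd)),
      hvz.trans ((h.2.2.2 hbz hdw).1 (hbc.trans hcd))⟩
  · rintro u ⟨y, ⟨a, ha, hay⟩, huy⟩
    exact ⟨y, ⟨⟨a, hay⟩, ⟨y, ⟨a, ha, hay⟩, le_rfl⟩⟩, huy⟩
  · ext x
    constructor
    · intro hx
      obtain ⟨a, ⟨⟨y, hay⟩, ha⟩, hxa⟩ := asymp x hx
      exact ⟨a, ⟨y, ⟨y, ⟨a, ha, hay⟩, le_rfl⟩, hay⟩, hxa⟩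
    · rintro ⟨a, ⟨y, ⟨z, ⟨b, hb, hbz⟩, hyz⟩, hay⟩, hxa⟩
      exact hered hb (hxa.trans ((h.2.2.2 hay hbz).2 hyz))

theorem sigRel_flip (h : OrdPB φ) : sigRel (flip φ) = flip (sigRel φ) := by
  ext τ σ
  exact ⟨h.inverse.sigRel_flip_of_sigRel, h.sigRel_flip_of_sigRel⟩

theorem isPB_sigRel (h : OrdPB φ) : IsPB (sigRel φ) :=
  ⟨fun _ _ _ h₁ h₂ => h₁.2.trans h₂.2.symm, fun _ _ _ h₁ h₂ =>
    (h.sigRel_flip_of_sigRel h₁).2.trans (h.sigRel_flip_of_sigRel h₂).2.symm⟩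

/-- The two descriptions of the image of a string under a composition agree. -/
theorem hcl_comp (hφ : OrdPB φ) (hψ : OrdPB ψ) {σ : Set X}
    (hσ : Asymp σ {x | ∃ y, Relation.Comp φ ψ x y}) :
    hcl {z | ∃ x ∈ σ, Relation.Comp φ ψ x z} =
      hcl {z | ∃ y ∈ hcl {y | ∃ x ∈ σ, φ x y}, ψ y z} := by
  ext u
  constructor
  · rintro ⟨z, ⟨x, hx, y, hxy, hyz⟩, huz⟩
    exact ⟨z, ⟨y, ⟨y, ⟨x, hx, hxy⟩, le_rfl⟩, hyz⟩, huz⟩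
  · rintro ⟨z, ⟨y, ⟨y', ⟨a, ha, hay⟩, hyy⟩, hyz⟩, huz⟩
    obtain ⟨b, ⟨⟨w, v, hbv, hvw⟩, hb⟩, hab⟩ := hσ a ha
    exact ⟨w, ⟨b, hb, v, hbv, hvw⟩,
      huz.trans ((hψ.2.2.2 hyz hvw).1 (hyy.trans ((hφ.2.2.2 hay hbv).1 hab)))⟩

theorem sigRel_comp (hφ : OrdPB φ) (hψ : OrdPB ψ) :
    sigRel (Relation.Comp φ ψ) = Relation.Comp (sigRel φ) (sigRel ψ) := by
  ext σ τ
  constructor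
  · rintro ⟨⟨hσ, asymp⟩, rfl⟩
    have hσφ : sigRel φ σ (hcl {y | ∃ x ∈ σ, φ x y}) := by
      refine ⟨⟨hσ, fun x hx => ?_⟩, rfl⟩
      obtain ⟨a, ⟨⟨z, y, hay, -⟩, ha⟩, hxa⟩ := asymp x hx
      exact ⟨a, ⟨⟨y, hay⟩, ha⟩, hxa⟩
    refine ⟨_, hσφ, ⟨(hφ.sigRel_flip_of_sigRel hσφ).1.1, ?_⟩, hφ.hcl_comp hψ asymp⟩
    rintro u ⟨y, ⟨a, ha, hay⟩, huy⟩
    obtain ⟨b, ⟨⟨w, v, hbv, hvw⟩, hb⟩, hab⟩ := asymp a ha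
    exact ⟨v, ⟨⟨w, hvw⟩, v, ⟨b, hb, hbv⟩, le_rfl⟩, huy.trans ((hφ.2.2.2 hay hbv).1 hab)⟩
  · rintro ⟨_, ⟨⟨hσ, hσφ⟩, rfl⟩, ⟨-, hρψ⟩, rfl⟩
    have asymp : Asymp σ {x | ∃ y, Relation.Comp φ ψ x y} := by
      intro x hx
      obtain ⟨a, ⟨⟨y, hay⟩, ha⟩, hxa⟩ := hσφ x hx
      obtain ⟨v, ⟨⟨w, hvw⟩, z, ⟨b, hb, hbz⟩, hvz⟩, hyv⟩ := hρψ y ⟨y, ⟨a, ha, hay⟩, le_rfl⟩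
      obtain ⟨c, hcv⟩ := hφ.2.2.1 ⟨a, hay⟩ ⟨b, hbz⟩ hyv hvz
      exact ⟨c, ⟨⟨w, v, hcv, hvw⟩, hσ.2.1 hb ((hφ.2.2.2 hcv hbz).2 hvz)⟩,
        hxa.trans ((hφ.2.2.2 hay hcv).2 hyv)⟩
    exact ⟨⟨hσ, asymp⟩, (hφ.hcl_comp hψ asymp).symm⟩

end OrdPB

/-- The domain of `φ^Σ` consists of the strings asymptotically contained in that of `φ`. -/
theorem exists_sigRel_iff {X : Type*} [Preorder X] {φ : X → X → Prop} {σ : Set X} :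
    (∃ τ, sigRel φ σ τ) ↔ (IsStringO σ ∧ Asymp σ {x | ∃ y, φ x y}) :=
  ⟨fun ⟨_, h⟩ => h.1, fun h => ⟨_, h, rfl⟩⟩

/-- `I₊(X)` is an inverse subsemigroup of the symmetric inverse semigroup `I(X)`
(closed under inverses `flip` and composition `Relation.Comp`, applying the first
argument first), and `φ ↦ φ^Σ` is a semigroup homomorphism `I₊(X) → I(Σ(X))`; in
particular each `φ^Σ` is a partial bijection with domain `{σ : σ ⊑ F_φ}`, range
`{τ : τ ⊑ E_φ}`, and inverse `(φ⁻¹)^Σ`. -/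
theorem orderPartialBij.sigmaRepresentation {X : Type*} [Preorder X] :
    (∀ φ : X → X → Prop, OrdPB φ → OrdPB (flip φ)) ∧
    (∀ φ ψ : X → X → Prop, OrdPB φ → OrdPB ψ → OrdPB (Relation.Comp φ ψ)) ∧
    (∀ φ ψ : X → X → Prop, OrdPB φ → OrdPB ψ →
      sigRel (Relation.Comp φ ψ) = Relation.Comp (sigRel φ) (sigRel ψ)) ∧
    (∀ φ : X → X → Prop, OrdPB φ → IsPB (sigRel φ)) ∧
    (∀ φ : X → X → Prop, OrdPB φ → ∀ σ : Set X,
      (∃ τ, sigRel φ σ τ) ↔ (IsStringO σ ∧ Asymp σ {x | ∃ y, φ x y})) ∧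
    (∀ φ : X → X → Prop, OrdPB φ → ∀ τ : Set X,
      (∃ σ, sigRel φ σ τ) ↔ (IsStringO τ ∧ Asymp τ {y | ∃ x, φ x y})) ∧
    (∀ φ : X → X → Prop, OrdPB φ → sigRel (flip φ) = flip (sigRel φ)) := by
  refine ⟨fun φ h => h.inverse, fun φ ψ hφ hψ => hφ.comp hψ, fun φ ψ hφ hψ => hφ.sigRel_comp hψ,
    fun φ h => h.isPB_sigRel, fun φ _ σ => exists_sigRel_iff, fun φ h τ => ?_,
    fun φ h => h.sigRel_flip⟩
  have := exists_sigRel_iff (φ := flip φ) (σ := τ)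
  rwa [h.sigRel_flip] at this
end

section
/- Let E be a meet semilattice with zero and let J be an ideal of E (a nonempty subset with JE ⊆ J). Then the map i sending a filter η of J to the filter ⟨η⟩ = {x ∈ E : ∃ y ∈ η, y ≤ x} of E is a bijection from the set of filters of J onto U = {ξ : ξ is a filter of E with ξ ∩ J ≠ ∅}, with inverse p(ξ) = ξ ∩ J; both i and p preserve inclusion of filters, U is open in the filter space of E, and i is a homeomorphism onto U for the topologies induced by identifying filters with characters carrying the product topology from {0,1}^E (respectively {0,1}^J). -/
/-- A filter on a meet semilattice `E` with zero, encoded by its indicator function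
`f : E → Bool` (a character): `{x | f x = true}` is nonempty, does not contain `⊥`,
and is closed under meets and upward closed. -/
def IsFilterFun {E : Type*} [SemilatticeInf E] [OrderBot E] (f : E → Bool) : Prop :=
  (∃ x, f x = true) ∧ f ⊥ = false ∧
  (∀ x y : E, f x = true → f y = true → f (x ⊓ y) = true) ∧
  (∀ x y : E, f y = true → y ≤ x → f x = true)

/-- An ideal of a meet semilattice: a nonempty subset `J` with `JE ⊆ J`. -/
def IsIdealSet {E : Type*} [SemilatticeInf E] (J : Set E) : Prop :=
  J.Nonempty ∧ ∀ x ∈ J, ∀ y : E, x ⊓ y ∈ J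

/-- A filter on the subsemilattice `J` of `E`, encoded by its indicator function
`g : J → Bool`. -/
def IsFilterFunIn {E : Type*} [SemilatticeInf E] [OrderBot E] (J : Set E)
    (g : J → Bool) : Prop :=
  (∃ x, g x = true) ∧
  (∀ x : J, (x : E) = ⊥ → g x = false) ∧
  (∀ x y z : J, g x = true → g y = true → (z : E) = (x : E) ⊓ (y : E) → g z = true) ∧
  (∀ x y : J, g y = true → (y : E) ≤ (x : E) → g x = true)

open Classical in
/-- The indicator function of the upward closure in `E` of the subset of `J` with indicator
function `g`. -/
noncomputable def upClosureFun {E : Type*} [SemilatticeInf E] (J : Set E) (g : J → Bool) :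
    E → Bool :=
  fun x => decide (∃ y : J, g y = true ∧ (y : E) ≤ x)

theorem upClosureFun_eq_true_iff {E : Type*} [SemilatticeInf E] {J : Set E} {g : J → Bool}
    {x : E} : upClosureFun J g x = true ↔ ∃ y : J, g y = true ∧ (y : E) ≤ x := by
  simp [upClosureFun]

theorem IsFilterFunIn.isFilterFun_upClosureFun {E : Type*} [SemilatticeInf E] [OrderBot E]
    {J : Set E} (hJ : IsIdealSet J) {g : J → Bool} (hg : IsFilterFunIn J g) :
    IsFilterFun (upClosureFun J g) := by
  obtain ⟨⟨y₀, hy₀⟩, hbot, hinf, -⟩ := hg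
  refine ⟨⟨y₀, upClosureFun_eq_true_iff.2 ⟨y₀, hy₀, le_rfl⟩⟩, ?_, fun a b ha hb => ?_,
    fun a b hb hba => ?_⟩
  · rw [Bool.eq_false_iff, Ne, upClosureFun_eq_true_iff]
    rintro ⟨y, hy, hle⟩
    simp [hbot y (le_bot_iff.1 hle)] at hy
  · obtain ⟨y, hy, hya⟩ := upClosureFun_eq_true_iff.1 ha
    obtain ⟨z, hz, hzb⟩ := upClosureFun_eq_true_iff.1 hb
    exact upClosureFun_eq_true_iff.2
      ⟨⟨(y : E) ⊓ z, hJ.2 y y.2 z⟩, hinf y z _ hy hz rfl, inf_le_inf hya hzb⟩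
  · obtain ⟨y, hy, hyb⟩ := upClosureFun_eq_true_iff.1 hb
    exact upClosureFun_eq_true_iff.2 ⟨y, hy, hyb.trans hba⟩

theorem IsFilterFunIn.upClosureFun_coe {E : Type*} [SemilatticeInf E] [OrderBot E]
    {J : Set E} {g : J → Bool} (hg : IsFilterFunIn J g) (y : J) :
    upClosureFun J g y = g y := by
  rw [Bool.eq_iff_iff, upClosureFun_eq_true_iff]
  exact ⟨fun ⟨z, hz, hzy⟩ => hg.2.2.2 y z hz hzy, fun hy => ⟨y, hy, le_rfl⟩⟩

theorem IsFilterFunIn.upClosureFun_eq_apply_inf {E : Type*} [SemilatticeInf E] [OrderBot E]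
    {J : Set E} (hJ : IsIdealSet J) {g : J → Bool} (hg : IsFilterFunIn J g) {y : J}
    (hy : g y = true) (x : E) :
    upClosureFun J g x = g ⟨(y : E) ⊓ x, hJ.2 y y.2 x⟩ := by
  rw [Bool.eq_iff_iff, upClosureFun_eq_true_iff]
  refine ⟨fun ⟨z, hz, hzx⟩ => ?_, fun h => ⟨_, h, inf_le_right⟩⟩
  exact hg.2.2.2 _ ⟨(y : E) ⊓ z, hJ.2 y y.2 z⟩ (hg.2.2.1 y z _ hy hz rfl)
    (inf_le_inf_left _ hzx)

theorem continuous_upClosureFun {E : Type*} [SemilatticeInf E] [OrderBot E]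
    {J : Set E} (hJ : IsIdealSet J) :
    Continuous fun g : {g : J → Bool // IsFilterFunIn J g} => upClosureFun J g.1 := by
  have heval (y : J) : Continuous fun g : {g : J → Bool // IsFilterFunIn J g} => g.1 y :=
    (continuous_apply y).comp continuous_subtype_val
  refine continuous_pi fun x => continuous_iff_continuousAt.2 fun g => ?_
  obtain ⟨y, hy⟩ := g.2.1
  refine (heval ⟨(y : E) ⊓ x, hJ.2 y y.2 x⟩).continuousAt.congr ?_
  filter_upwards [((isOpen_discrete {true}).preimage (heval y)).mem_nhds hy] with k hk
  exact (k.2.upClosureFun_eq_apply_inf hJ hk x).symm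

/-- The trace on an ideal `J` of a filter of `E` meeting `J` is a filter of `J`. -/
theorem IsFilterFun.isFilterFunIn_restrict {E : Type*} [SemilatticeInf E] [OrderBot E]
    {J : Set E} {f : E → Bool} (hf : IsFilterFun f) (hfJ : ∃ x ∈ J, f x = true) :
    IsFilterFunIn J fun y => f y := by
  obtain ⟨x, hxJ, hx⟩ := hfJ
  refine ⟨⟨⟨x, hxJ⟩, hx⟩, fun y hy => ?_, fun a b c ha hb hc => ?_,
    fun a b => hf.2.2.2 a b⟩
  · simpa only [hy] using hf.2.1
  · simpa only [hc] using hf.2.2.1 a b ha hb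

/-- A filter of `E` meeting an ideal `J` is generated by its trace on `J`. -/
theorem IsFilterFun.upClosureFun_restrict {E : Type*} [SemilatticeInf E] [OrderBot E]
    {J : Set E} (hJ : IsIdealSet J) {f : E → Bool} (hf : IsFilterFun f)
    (hfJ : ∃ x ∈ J, f x = true) : upClosureFun J (fun y => f y) = f := by
  obtain ⟨y, hyJ, hy⟩ := hfJ
  funext x
  rw [Bool.eq_iff_iff, upClosureFun_eq_true_iff]
  exact ⟨fun ⟨z, hz, hzx⟩ => hf.2.2.2 x z hz hzx,
    fun hx => ⟨⟨y ⊓ x, hJ.2 y hyJ x⟩, hf.2.2.1 y x hy hx, inf_le_right⟩⟩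

theorem isOpen_setOf_isFilterFun_meets {E : Type*} [SemilatticeInf E] [OrderBot E]
    (J : Set E) : IsOpen {f : {f : E → Bool // IsFilterFun f} | ∃ x ∈ J, f.1 x = true} := by
  have h : {f : {f : E → Bool // IsFilterFun f} | ∃ x ∈ J, f.1 x = true} =
      ⋃ x ∈ J, (fun f : {f : E → Bool // IsFilterFun f} => f.1 x) ⁻¹' {true} := by
    ext f
    simp
  rw [h]
  exact isOpen_biUnion fun x _ =>
    (isOpen_discrete {true}).preimage ((continuous_apply x).comp continuous_subtype_val)

/-- Let `J` be an ideal of a meet semilattice `E` with zero.  The map `i` sending a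
filter `η` of `J` to the filter `⟨η⟩ = {x : ∃ y ∈ η, y ≤ x}` of `E` is a bijection onto
the open set `U` of filters of `E` meeting `J`, with inverse `p : ξ ↦ ξ ∩ J`; both
preserve inclusion, and `i` is a homeomorphism onto `U` for the topologies induced from
the product topologies on `{0,1}^E` and `{0,1}^J` via the identification of filters
with characters. -/
theorem semilattice.idealFilters {E : Type*} [SemilatticeInf E] [OrderBot E]
    (J : Set E) (hJ : IsIdealSet J) :
    ∃ i : {g : J → Bool // IsFilterFunIn J g} → {f : E → Bool // IsFilterFun f},
      (∀ (g : {g : J → Bool // IsFilterFunIn J g}) (x : E),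
        (i g).1 x = true ↔ ∃ y : J, g.1 y = true ∧ (y : E) ≤ x) ∧
      IsOpen {f : {f : E → Bool // IsFilterFun f} | ∃ x ∈ J, f.1 x = true} ∧
      Set.range i = {f : {f : E → Bool // IsFilterFun f} | ∃ x ∈ J, f.1 x = true} ∧
      Function.Injective i ∧
      (∀ (g : {g : J → Bool // IsFilterFunIn J g}) (y : J), (i g).1 (y : E) = g.1 y) ∧
      (∀ g₁ g₂ : {g : J → Bool // IsFilterFunIn J g},
        (∀ y : J, g₁.1 y = true → g₂.1 y = true) ↔
          (∀ x : E, (i g₁).1 x = true → (i g₂).1 x = true)) ∧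
      Continuous i ∧ IsOpenMap i := by
  let i : {g : J → Bool // IsFilterFunIn J g} → {f : E → Bool // IsFilterFun f} :=
    fun g => ⟨upClosureFun J g.1, g.2.isFilterFun_upClosureFun hJ⟩
  have hmem (g : {g : J → Bool // IsFilterFunIn J g}) (x : E) :
      (i g).1 x = true ↔ ∃ y : J, g.1 y = true ∧ (y : E) ≤ x := upClosureFun_eq_true_iff
  have hcoe (g : {g : J → Bool // IsFilterFunIn J g}) (y : J) : (i g).1 (y : E) = g.1 y :=
    g.2.upClosureFun_coe y
  have hopen := isOpen_setOf_isFilterFun_meets J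
  have hrange : Set.range i =
      {f : {f : E → Bool // IsFilterFun f} | ∃ x ∈ J, f.1 x = true} := by
    ext f
    constructor
    · rintro ⟨g, rfl⟩
      obtain ⟨y, hy⟩ := g.2.1
      exact ⟨y, y.2, (hcoe g y).trans hy⟩
    · exact fun hf => ⟨⟨_, f.2.isFilterFunIn_restrict hf⟩,
        Subtype.ext (f.2.upClosureFun_restrict hJ hf)⟩
  have hcont : Continuous i := (continuous_upClosureFun hJ).subtype_mk _
  let p : {f : E → Bool // IsFilterFun f} → J → Bool := fun f y => f.1 y
  have hp : Continuous p :=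
    continuous_pi fun y => (continuous_apply (y : E)).comp continuous_subtype_val
  have hpi : p ∘ i = Subtype.val := funext fun g => funext (hcoe g)
  have hemb : Topology.IsEmbedding i :=
    .of_comp hcont hp (hpi ▸ Topology.IsEmbedding.subtypeVal)
  refine ⟨i, hmem, hopen, hrange, hemb.injective, hcoe, fun g₁ g₂ => ⟨fun h x hx => ?_,
    fun h y hy => ?_⟩, hcont, (Topology.IsOpenEmbedding.mk hemb (hrange ▸ hopen)).isOpenMap⟩
  · obtain ⟨y, hy, hyx⟩ := (hmem g₁ x).1 hx
    exact (hmem g₂ x).2 ⟨y, h y hy, hyx⟩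
  · exact (hcoe g₂ y).symm.trans (h y ((hcoe g₁ y).trans hy))
end

section
/- Let E be a meet semilattice with zero, let B be a (not necessarily unital) Boolean algebra, let π : E → B be a representation (π(0) = 0 and π(xy) = π(x) ∧ π(y) for all x, y ∈ E), and let φ be a character of E. Then there exists a character χ of B preserving finite meets and finite joins with φ = χ ∘ π if and only if φ is π-tight, i.e. for all x, y₁, …, y_n ∈ E, π(x) ≤ π(y₁) ∨ ⋯ ∨ π(y_n) implies φ(x) ≤ φ(y₁) ∨ ⋯ ∨ φ(y_n). -/
/-- A character of a meet semilattice `E` with zero: a nonzero map `E → {0,1}` killing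
`⊥` and preserving meets. -/
def IsCharSL {E : Type*} [SemilatticeInf E] [OrderBot E] (φ : E → Bool) : Prop :=
  (∃ x, φ x = true) ∧ φ ⊥ = false ∧ ∀ x y : E, φ (x ⊓ y) = (φ x && φ y)

/-- A character of a (not necessarily unital) Boolean algebra `B` preserving finite
meets and finite joins: a nonzero map `B → {0,1}` killing `⊥` and preserving `⊓`
and `⊔`. -/
def IsCharBA {B : Type*} [GeneralizedBooleanAlgebra B] (χ : B → Bool) : Prop :=
  (∃ b, χ b = true) ∧ χ ⊥ = false ∧
  (∀ a b : B, χ (a ⊓ b) = (χ a && χ b)) ∧ (∀ a b : B, χ (a ⊔ b) = (χ a || χ b))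

/-- A prime ideal of a generalized Boolean algebra is the zero set of a character. -/
theorem Order.Ideal.IsPrime.exists_isCharBA {B : Type*} [GeneralizedBooleanAlgebra B]
    {J : Order.Ideal B} (hJ : J.IsPrime) :
    ∃ χ : B → Bool, IsCharBA χ ∧ ∀ b, χ b = true ↔ b ∉ J := by
  classical
  obtain ⟨b, hb⟩ := Set.nonempty_compl.2 (J.isProper_iff.1 hJ.toIsProper)
  refine ⟨fun b => decide (b ∉ J), ⟨⟨b, by simpa using hb⟩, by simp [J.bot_mem],
    fun a b => ?_, fun a b => ?_⟩, by simp⟩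
  · have h : a ⊓ b ∈ J ↔ a ∈ J ∨ b ∈ J :=
      ⟨hJ.mem_or_mem, fun h => h.elim (J.lower inf_le_left) (J.lower inf_le_right)⟩
    simp [h]
  · simp [Order.Ideal.sup_mem_iff]

/-- A character of a generalized Boolean algebra takes the value `true` on a finite join only if
it does so on one of the terms. -/
theorem IsCharBA.exists_of_le_finset_sup {E B : Type*} [GeneralizedBooleanAlgebra B]
    {χ : B → Bool} (hχ : IsCharBA χ) {π : E → B} {b : B} {Y : Finset E}
    (hb : b ≤ Y.sup π) (hχb : χ b = true) : ∃ y ∈ Y, χ (π y) = true := by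
  obtain ⟨-, hbot, hinf, hsup⟩ := hχ
  have hY : χ (Y.sup π) = true := by
    have h := hinf b (Y.sup π)
    rw [inf_eq_left.2 hb, hχb] at h
    simpa using h.symm
  clear hb
  classical
  induction Y using Finset.induction_on with
  | empty => simp [hbot] at hY
  | insert a s _ ih =>
    rw [Finset.sup_insert, hsup, Bool.or_eq_true] at hY
    rcases hY with h | h
    · exact ⟨a, Finset.mem_insert_self a s, h⟩
    · obtain ⟨y, hy, hχy⟩ := ih h
      exact ⟨y, Finset.mem_insert_of_mem hy, hχy⟩

/-- Let `π : E → B` be a representation of a meet semilattice with zero in a (not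
necessarily unital) Boolean algebra, and let `φ` be a character of `E`.  Then `φ`
factors as `χ ∘ π` for a character `χ` of `B` preserving finite meets and joins if and
only if `φ` is `π`-tight:  `π x ≤ π y₁ ∨ ⋯ ∨ π yₙ` implies
`φ x ≤ φ y₁ ∨ ⋯ ∨ φ yₙ`. -/
theorem semilattice.factorThroughBoolean {E B : Type*}
    [SemilatticeInf E] [OrderBot E] [GeneralizedBooleanAlgebra B]
    (π : E → B) (hπ0 : π ⊥ = ⊥) (hπ : ∀ x y : E, π (x ⊓ y) = π x ⊓ π y)
    (φ : E → Bool) (hφ : IsCharSL φ) :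
    (∃ χ : B → Bool, IsCharBA χ ∧ ∀ x : E, φ x = χ (π x)) ↔
      (∀ (x : E) (Y : Finset E), π x ≤ Y.sup π →
        φ x = true → ∃ y ∈ Y, φ y = true) := by
  constructor
  · rintro ⟨χ, hχ, hφχ⟩ x Y hle hx
    rw [hφχ] at hx
    simpa only [hφχ] using hχ.exists_of_le_finset_sup hle hx
  · intro htight
    classical
    obtain ⟨⟨x₀, hx₀⟩, -, hinf⟩ := hφ
    have hF : Order.IsPFilter {b : B | ∃ x, φ x = true ∧ π x ≤ b} := by
      refine .of_def ⟨π x₀, x₀, hx₀, le_rfl⟩ ?_ ?_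
      · rintro a ⟨x, hx, hxa⟩ b ⟨y, hy, hyb⟩
        refine ⟨a ⊓ b, ⟨x ⊓ y, by simp [hinf, hx, hy], ?_⟩, inf_le_left, inf_le_right⟩
        rw [hπ]
        exact inf_le_inf hxa hyb
      · rintro a b hab ⟨x, hx, hxa⟩
        exact ⟨x, hx, hxa.trans hab⟩
    have hI : Order.IsIdeal {b : B | ∃ Y : Finset E, (∀ y ∈ Y, φ y = false) ∧ b ≤ Y.sup π} := by
      refine ⟨?_, ⟨⊥, ∅, by simp, bot_le⟩, ?_⟩
      · rintro a b hba ⟨Y, hY, haY⟩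
        exact ⟨Y, hY, hba.trans haY⟩
      · rintro a ⟨Y, hY, haY⟩ b ⟨Z, hZ, hbZ⟩
        refine ⟨a ⊔ b, ⟨Y ∪ Z, fun y hy => ?_, ?_⟩, le_sup_left, le_sup_right⟩
        · exact (Finset.mem_union.1 hy).elim (hY y) (hZ y)
        · rw [Finset.sup_union]
          exact sup_le_sup haY hbZ
    have hFI : Disjoint (hF.toPFilter : Set B) (hI.toIdeal : Set B) := by
      rw [Set.disjoint_left]
      rintro b ⟨x, hx, hxb⟩ ⟨Y, hY, hbY⟩
      obtain ⟨y, hy, hφy⟩ := htight x Y (hxb.trans hbY) hx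
      simp [hY y hy] at hφy
    obtain ⟨J, hJ, hIJ, hFJ⟩ := DistribLattice.prime_ideal_of_disjoint_filter_ideal hFI
    obtain ⟨χ, hχ, hχJ⟩ := hJ.exists_isCharBA
    refine ⟨χ, hχ, fun x => ?_⟩
    rw [Bool.eq_iff_iff, hχJ]
    refine ⟨fun hx => Set.disjoint_left.1 hFJ ⟨x, hx, le_rfl⟩, fun hx => ?_⟩
    by_contra hφx
    exact hx (hIJ ⟨{x}, by simpa using hφx, by simp⟩)
end
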